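/- arXiv:2411.07054 — 3 statements merged into one kernel-verified Lean document; each statement's English description precedes it below -/
import Mathlib

section
/- Let K ⊂ ℝ^d be compact and let (f_ε)_{ε∈(0,1)} be a net of smooth functions on ℝ^d with supp f_ε ⊆ K for all ε, which is (M_p)-regular, i.e., there exists s > 0 such that for every h > 0 there are C > 0 and ε_1 ∈ (0,1) with sup_{x∈K, α∈ℕ^d} |∂^α f_ε(x)|/(h^{|α|} M_{|α|}) ≤ C·e^{M(s/ε)} for all ε < ε_1. Assume that for every h > 0 and every smooth κ : ℝ^d → ℂ with supp κ ⊆ K satisfying sup_{x,α} |∂^α κ(x)|/(λ^{|α|} M_{|α|}) < ∞ for every λ > 0, there exist ε_0 = ε_{0,h,κ} ∈ (0,1) and C = C_{h,κ} > 0 such that |∫_{ℝ^d} f_ε(x) κ(x) dx|·e^{M(h/ε)} ≤ C for all ε < ε_0 (thus ε_0 may depend on h and κ). Then (f_ε) is (M_p)-negligible. -/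
open scoped BigOperators

/-- `log₊ x = max (log x) 0`. -/
noncomputable def logPlus (x : ℝ) : ℝ := max (Real.log x) 0

/-- The associated function `M(ρ) = sup_p log₊ (ρ^p / M_p)`. -/
noncomputable def assocM (Mp : ℕ → ℝ) (ρ : ℝ) : ℝ :=
  ⨆ p : ℕ, logPlus (ρ ^ p / Mp p)

/-- `N_{(r_i)}(ρ) = sup_p log₊ (ρ^p / (M_p · Π_{i=1}^p r_i))`
(the sequence `(r_i)_{i≥1}` is indexed here by `ℕ`, `r 0 = r_1`, etc.). -/
noncomputable def assocN (Mp : ℕ → ℝ) (r : ℕ → ℝ) (ρ : ℝ) : ℝ :=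
  ⨆ p : ℕ, logPlus (ρ ^ p / (Mp p * ∏ i ∈ Finset.range p, r i))

/-- `(r_i) ∈ 𝕽`: positive, monotonically increasing, tending to infinity. -/
def InRcal (r : ℕ → ℝ) : Prop :=
  (∀ i, 0 < r i) ∧ Monotone r ∧ Filter.Tendsto r Filter.atTop Filter.atTop

/-- Condition (M.1): logarithmic convexity. -/
def CondM1 (Mp : ℕ → ℝ) : Prop :=
  ∀ p : ℕ, (Mp (p + 1)) ^ 2 ≤ Mp p * Mp (p + 2)

/-- Condition (M.2) with constants `c0, H`. -/
def CondM2 (Mp : ℕ → ℝ) (c0 H : ℝ) : Prop :=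
  ∀ p q : ℕ, Mp (p + q) ≤ c0 * H ^ (p + q) * Mp p * Mp q

/-- Condition (M.2). -/
def CondM2' (Mp : ℕ → ℝ) : Prop :=
  ∃ c0 H : ℝ, 1 ≤ c0 ∧ 1 ≤ H ∧ CondM2 Mp c0 H

/-- Condition (M.3): `Σ_{j=p+1}^∞ M_{j-1}/M_j ≤ c0 · p · M_p / M_{p+1}`. -/
def CondM3 (Mp : ℕ → ℝ) : Prop :=
  ∃ c0 : ℝ, 1 ≤ c0 ∧ ∀ p : ℕ, 1 ≤ p →
    ∑' n : ℕ, Mp (p + n) / Mp (p + n + 1) ≤ c0 * p * Mp p / Mp (p + 1)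

/-- The partial derivative `∂_j` of a function on `ℝ^d`. -/
noncomputable def pderiv1 {d : ℕ} (j : Fin d) (f : EuclideanSpace ℝ (Fin d) → ℂ) :
    EuclideanSpace ℝ (Fin d) → ℂ :=
  fun x => fderiv ℝ f x (EuclideanSpace.single j 1)

/-- The multi-index partial derivative `∂^α = ∂_1^{α_1} ⋯ ∂_d^{α_d}`. -/
noncomputable def mderiv {d : ℕ} (α : Fin d → ℕ) (f : EuclideanSpace ℝ (Fin d) → ℂ) :
    EuclideanSpace ℝ (Fin d) → ℂ :=
  (List.finRange d).foldr (fun j g => (pderiv1 j)^[α j] g) f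

/-- An `(M_p)`-moderate net of smooth functions on `ℝ^d`. -/
def ModerateB {d : ℕ} (Mp : ℕ → ℝ) (f : ℝ → EuclideanSpace ℝ (Fin d) → ℂ) : Prop :=
  ∀ K' : Set (EuclideanSpace ℝ (Fin d)), IsCompact K' → ∀ h : ℝ, 0 < h →
    ∃ k : ℝ, 0 < k ∧ ∃ C : ℝ, 0 < C ∧ ∃ ε₀ ∈ Set.Ioo (0 : ℝ) 1,
      ∀ ε : ℝ, 0 < ε → ε < ε₀ → ∀ x ∈ K', ∀ α : Fin d → ℕ,
        ‖mderiv α (f ε) x‖ / (h ^ (∑ j, α j) * Mp (∑ j, α j)) ≤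
          C * Real.exp (assocM Mp (k / ε))

/-- An `(M_p)`-negligible net of smooth functions on `ℝ^d`. -/
def NegligibleB {d : ℕ} (Mp : ℕ → ℝ) (f : ℝ → EuclideanSpace ℝ (Fin d) → ℂ) : Prop :=
  ∀ K' : Set (EuclideanSpace ℝ (Fin d)), IsCompact K' → ∀ h : ℝ, 0 < h → ∀ k : ℝ, 0 < k →
    ∃ C : ℝ, 0 < C ∧ ∃ ε₀ ∈ Set.Ioo (0 : ℝ) 1,
      ∀ ε : ℝ, 0 < ε → ε < ε₀ → ∀ x ∈ K', ∀ α : Fin d → ℕ,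
        ‖mderiv α (f ε) x‖ / (h ^ (∑ j, α j) * Mp (∑ j, α j)) ≤
          C * Real.exp (-assocM Mp (k / ε))

/-- The Euclidean space `ℝ^d`. -/
abbrev Euc (d : ℕ) := EuclideanSpace ℝ (Fin d)

section Derivatives

variable {d : ℕ}

/-- The iterated partial derivative along a list of coordinate directions. -/
noncomputable def lderiv (l : List (Fin d)) (f : Euc d → ℂ) : Euc d → ℂ :=
  l.foldr pderiv1 f

theorem lderiv_append (l l' : List (Fin d)) (f : Euc d → ℂ) :
    lderiv (l ++ l') f = lderiv l (lderiv l' f) := by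
  simp [lderiv]

theorem contDiff_pderiv1 (j : Fin d) {f : Euc d → ℂ} (hf : ContDiff ℝ (⊤ : ℕ∞) f) :
    ContDiff ℝ (⊤ : ℕ∞) (pderiv1 j f) := by
  have h : ContDiff ℝ (⊤ : ℕ∞) (fderiv ℝ f) := hf.fderiv_right (by simp)
  exact h.clm_apply contDiff_const

theorem contDiff_lderiv (l : List (Fin d)) {f : Euc d → ℂ} (hf : ContDiff ℝ (⊤ : ℕ∞) f) :
    ContDiff ℝ (⊤ : ℕ∞) (lderiv l f) := by
  induction l with
  | nil => exact hf
  | cons j l ih => exact contDiff_pderiv1 j ih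

theorem pderiv1_comm (i j : Fin d) {f : Euc d → ℂ} (hf : ContDiff ℝ (⊤ : ℕ∞) f) :
    pderiv1 i (pderiv1 j f) = pderiv1 j (pderiv1 i f) := by
  have h : Differentiable ℝ (fderiv ℝ f) :=
    (hf.fderiv_right (m := (⊤ : ℕ∞)) (by simp)).differentiable (by simp)
  have key : ∀ (i j : Fin d) (x : Euc d), pderiv1 i (pderiv1 j f) x =
      fderiv ℝ (fderiv ℝ f) x (EuclideanSpace.single i 1) (EuclideanSpace.single j 1) := by
    intro i j x
    have := fderiv_clm_apply (h x) (differentiableAt_const (EuclideanSpace.single j (1 : ℝ)))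
    change fderiv ℝ (fun y => fderiv ℝ f y (EuclideanSpace.single j 1)) x _ = _
    rw [this]
    simp
  ext x
  rw [key, key]
  exact ((contDiff_infty.1 hf 2).contDiffAt.isSymmSndFDerivAt (by simp)) _ _

theorem lderiv_perm {l l' : List (Fin d)} (h : l.Perm l') {f : Euc d → ℂ}
    (hf : ContDiff ℝ (⊤ : ℕ∞) f) : lderiv l f = lderiv l' f := by
  induction h with
  | nil => rfl
  | cons j _ ih => exact congrArg (pderiv1 j) ih
  | swap i j l => exact pderiv1_comm j i (contDiff_lderiv l hf)
  | trans _ _ ih ih' => exact ih.trans ih'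

/-- The list of directions underlying a multi-index, restricted to the coordinates in `L`. -/
def indexList (L : List (Fin d)) (α : Fin d → ℕ) : List (Fin d) :=
  L.flatMap fun j => List.replicate (α j) j

theorem lderiv_replicate (n : ℕ) (j : Fin d) (f : Euc d → ℂ) :
    lderiv (List.replicate n j) f = (pderiv1 j)^[n] f := by
  induction n with
  | zero => rfl
  | succ n ih =>
    rw [Function.iterate_succ_apply', ← ih]
    rfl

theorem foldr_pderiv1_eq_lderiv (L : List (Fin d)) (α : Fin d → ℕ) (f : Euc d → ℂ) :
    L.foldr (fun j g => (pderiv1 j)^[α j] g) f = lderiv (indexList L α) f := by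
  induction L with
  | nil => rfl
  | cons j L ih =>
    simp only [List.foldr_cons, ih, indexList, List.flatMap_cons, lderiv_append, lderiv_replicate]

theorem mderiv_eq_lderiv (α : Fin d → ℕ) (f : Euc d → ℂ) :
    mderiv α f = lderiv (indexList (List.finRange d) α) f :=
  foldr_pderiv1_eq_lderiv _ α f

theorem length_indexList (α : Fin d → ℕ) :
    (indexList (List.finRange d) α).length = ∑ j, α j := by
  simp [indexList, List.length_flatMap, Fin.sum_univ_def]

theorem exists_lderiv_eq_mderiv (l : List (Fin d)) {f : Euc d → ℂ}
    (hf : ContDiff ℝ (⊤ : ℕ∞) f) :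
    ∃ α : Fin d → ℕ, ∑ j, α j = l.length ∧ lderiv l f = mderiv α f := by
  have hp : l.Perm (indexList (List.finRange d) fun j => l.count j) := by
    rw [List.perm_iff_count]
    intro a
    simp [indexList, List.count_flatMap, List.count_replicate, Function.comp_def]
    rw [← Fin.sum_univ_def]
    simp
  refine ⟨fun j => l.count j, ?_, ?_⟩
  · rw [← length_indexList, hp.length_eq]
  · rw [mderiv_eq_lderiv, lderiv_perm hp hf]

theorem lderiv_eq_iteratedFDeriv (l : List (Fin d)) {f : Euc d → ℂ}
    (hf : ContDiff ℝ (⊤ : ℕ∞) f) (x : Euc d) :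
    lderiv l f x =
      iteratedFDeriv ℝ l.length f x fun i => EuclideanSpace.single (l.get i) 1 := by
  induction l generalizing x with
  | nil => simp [lderiv]
  | cons j l ih =>
    have h1 : lderiv (j :: l) f = pderiv1 j (lderiv l f) := rfl
    have h2 : lderiv l f = fun x =>
      iteratedFDeriv ℝ l.length f x fun i => EuclideanSpace.single (l.get i) 1 := funext ih
    have hd : DifferentiableAt ℝ (iteratedFDeriv ℝ l.length f) x :=
      (hf.differentiable_iteratedFDeriv (by exact_mod_cast WithTop.coe_lt_top _)) x
    rw [h1, h2, pderiv1, fderiv_continuousMultilinear_apply_const_apply hd]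
    exact (iteratedFDeriv_succ_apply_left
      (fun i : Fin (l.length + 1) => EuclideanSpace.single ((j :: l).get i) (1 : ℝ))).symm

theorem norm_lderiv_le (l : List (Fin d)) {f : Euc d → ℂ} (hf : ContDiff ℝ (⊤ : ℕ∞) f)
    (x : Euc d) : ‖lderiv l f x‖ ≤ ‖iteratedFDeriv ℝ l.length f x‖ := by
  rw [lderiv_eq_iteratedFDeriv l hf]
  refine (ContinuousMultilinearMap.le_opNorm _ _).trans ?_
  simp

theorem norm_mderiv_le (α : Fin d → ℕ) {f : Euc d → ℂ} (hf : ContDiff ℝ (⊤ : ℕ∞) f)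
    (x : Euc d) : ‖mderiv α f x‖ ≤ ‖iteratedFDeriv ℝ (∑ j, α j) f x‖ := by
  rw [mderiv_eq_lderiv, ← length_indexList]
  exact norm_lderiv_le _ hf x

theorem norm_iteratedFDeriv_le_of_mderiv (n : ℕ) {f : Euc d → ℂ}
    (hf : ContDiff ℝ (⊤ : ℕ∞) f) (x : Euc d) {B : ℝ} (hB : 0 ≤ B)
    (h : ∀ α : Fin d → ℕ, ∑ j, α j = n → ‖mderiv α f x‖ ≤ B) :
    ‖iteratedFDeriv ℝ n f x‖ ≤ (d : ℝ) ^ n * B := by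
  refine ContinuousMultilinearMap.opNorm_le_bound (by positivity) fun m => ?_
  have hm : m = fun i => ∑ j, m i j • EuclideanSpace.single j (1 : ℝ) := by
    funext i
    ext k
    simp [Pi.single_apply]
  have hb : ∀ r : Fin n → Fin d,
      ‖iteratedFDeriv ℝ n f x fun i => EuclideanSpace.single (r i) (1 : ℝ)‖ ≤ B := by
    intro r
    obtain ⟨α, h1, h2⟩ := exists_lderiv_eq_mderiv (List.ofFn r) hf
    have h3 := lderiv_eq_iteratedFDeriv (List.ofFn r) hf x
    rw [h2] at h3
    have h4 := h α (by rw [h1]; simp)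
    rw [h3] at h4
    convert h4 using 2
    have key : ∀ (k : ℕ) (hk : k = n) (l : List (Fin d)) (hl : l.length = k)
        (hr : ∀ (i : Fin n), r i = l.get (Fin.cast (by omega) i)),
        (iteratedFDeriv ℝ n f x fun i => EuclideanSpace.single (r i) (1 : ℝ)) =
        iteratedFDeriv ℝ l.length f x fun i => EuclideanSpace.single (l.get i) (1 : ℝ) := by
      intro k hk l hl hr
      obtain rfl : n = l.length := by omega
      simp only [hr]
      rfl
    exact key n rfl _ (by simp) (by intro i; simp)
  have hexp : iteratedFDeriv ℝ n f x m = ∑ r : Fin n → Fin d, (∏ i, m i (r i)) •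
      iteratedFDeriv ℝ n f x fun i => EuclideanSpace.single (r i) (1 : ℝ) := by
    conv_lhs => rw [hm]
    have := (iteratedFDeriv ℝ n f x).toMultilinearMap.map_sum
      (fun i j => m i j • EuclideanSpace.single j (1 : ℝ))
    simp only [ContinuousMultilinearMap.coe_coe] at this
    rw [this]
    refine Finset.sum_congr rfl fun r _ => ?_
    exact (iteratedFDeriv ℝ n f x).map_smul_univ _ _
  rw [hexp]
  refine (norm_sum_le _ _).trans ?_
  calc ∑ r : Fin n → Fin d, ‖(∏ i, m i (r i)) •
      iteratedFDeriv ℝ n f x fun i => EuclideanSpace.single (r i) (1 : ℝ)‖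
      ≤ ∑ r : Fin n → Fin d, (∏ i, ‖m i‖) * B := by
        refine Finset.sum_le_sum fun r _ => ?_
        rw [norm_smul, norm_prod]
        gcongr with i
        · exact PiLp.norm_apply_le (m i) (r i)
        · exact hb r
    _ = (d : ℝ) ^ n * B * ∏ i, ‖m i‖ := by
        simp
        ring

end Derivatives

section Taylor

variable {V F : Type*} [NormedAddCommGroup V] [NormedSpace ℝ V] [NormedAddCommGroup F]
  [NormedSpace ℝ F]

theorem hasDerivAt_iteratedFDeriv_line {f : V → F} (hf : ContDiff ℝ (⊤ : ℕ∞) f) (n : ℕ)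
    (x v : V) (t : ℝ) :
    HasDerivAt (fun t : ℝ => iteratedFDeriv ℝ n f (x + t • v))
      (fderiv ℝ (iteratedFDeriv ℝ n f) (x + t • v) v) t := by
  have hd : DifferentiableAt ℝ (iteratedFDeriv ℝ n f) (x + t • v) :=
    (hf.differentiable_iteratedFDeriv (by exact_mod_cast WithTop.coe_lt_top _)) _
  have hl : HasDerivAt (fun t : ℝ => x + t • v) v t := by
    simpa using ((hasDerivAt_id t).smul_const v).const_add x
  exact hd.hasFDerivAt.comp_hasDerivAt t hl

theorem norm_iteratedFDeriv_add_le {f : V → F} (hf : ContDiff ℝ (⊤ : ℕ∞) f) (q n : ℕ) {B : ℝ}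
    (hB : ∀ y, ‖iteratedFDeriv ℝ (n + q) f y‖ ≤ B) (x v : V) :
    ‖iteratedFDeriv ℝ n f (x + v)‖ ≤
      ∑ i ∈ Finset.range q, ‖iteratedFDeriv ℝ (n + i) f x‖ * ‖v‖ ^ i / i.factorial +
        B * ‖v‖ ^ q / q.factorial := by
  induction q generalizing n v with
  | zero => simpa using hB (x + v)
  | succ q ih =>
    have ih' := ih (n + 1) (fun y => by
      rw [show n + 1 + q = n + (q + 1) by ring]; exact hB y)
    let P : ℝ → ℝ := fun t =>
      ∑ i ∈ Finset.range (q + 1), ‖iteratedFDeriv ℝ (n + i) f x‖ * (t * ‖v‖) ^ i / i.factorial +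
        B * (t * ‖v‖) ^ (q + 1) / (q + 1).factorial
    let P' : ℝ → ℝ := fun t => ‖v‖ *
      (∑ i ∈ Finset.range q, ‖iteratedFDeriv ℝ (n + 1 + i) f x‖ * (t * ‖v‖) ^ i / i.factorial +
        B * (t * ‖v‖) ^ q / q.factorial)
    have hmono : ∀ (c : ℝ) (i : ℕ) (t : ℝ),
        HasDerivAt (fun t : ℝ => c * (t * ‖v‖) ^ (i + 1) / (i + 1).factorial)
          (‖v‖ * (c * (t * ‖v‖) ^ i / i.factorial)) t := by
      intro c i t
      have h1 : HasDerivAt (fun t : ℝ => t * ‖v‖) ‖v‖ t := by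
        simpa using (hasDerivAt_id t).mul_const ‖v‖
      have h2 := ((h1.pow (i + 1)).const_mul c).div_const ((i + 1).factorial : ℝ)
      refine h2.congr_deriv ?_
      have : (i.factorial : ℝ) ≠ 0 := by positivity
      rw [Nat.factorial_succ]
      push_cast
      field_simp
    have hP : ∀ t, HasDerivAt P (P' t) t := by
      intro t
      have h1 : HasDerivAt (fun t : ℝ => ∑ i ∈ Finset.range q,
          ‖iteratedFDeriv ℝ (n + (i + 1)) f x‖ * (t * ‖v‖) ^ (i + 1) / (i + 1).factorial)
          (∑ i ∈ Finset.range q,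
            ‖v‖ * (‖iteratedFDeriv ℝ (n + (i + 1)) f x‖ * (t * ‖v‖) ^ i / i.factorial)) t :=
        HasDerivAt.fun_sum fun i _ => hmono _ i t
      have h2 := (h1.add_const (‖iteratedFDeriv ℝ n f x‖)).add (hmono B q t)
      have e1 : P = fun t : ℝ => (∑ i ∈ Finset.range q,
          ‖iteratedFDeriv ℝ (n + (i + 1)) f x‖ * (t * ‖v‖) ^ (i + 1) / (i + 1).factorial) +
          ‖iteratedFDeriv ℝ n f x‖ + B * (t * ‖v‖) ^ (q + 1) / (q + 1).factorial := by
        funext t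
        simp only [P]
        rw [Finset.sum_range_succ']
        simp
      rw [e1]
      refine h2.congr_deriv ?_
      simp only [P']
      rw [mul_add, Finset.mul_sum]
      congr 1
      refine Finset.sum_congr rfl fun i _ => ?_
      rw [show n + 1 + i = n + (i + 1) by ring]
    have main := image_norm_le_of_norm_deriv_right_le_deriv_boundary
      (f := fun t : ℝ => iteratedFDeriv ℝ n f (x + t • v)) (a := 0) (b := 1)
      (f' := fun t : ℝ => fderiv ℝ (iteratedFDeriv ℝ n f) (x + t • v) v)
      (fun t _ => (hasDerivAt_iteratedFDeriv_line hf n x v t).continuousAt.continuousWithinAt)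
      (fun t _ => (hasDerivAt_iteratedFDeriv_line hf n x v t).hasDerivWithinAt)
      (B := P) (B' := P') (by simp [P, Finset.sum_range_succ']) hP
      (fun t ht => by
        refine (ContinuousLinearMap.le_opNorm _ _).trans ?_
        rw [norm_fderiv_iteratedFDeriv, mul_comm]
        have := ih' (t • v)
        rw [norm_smul, Real.norm_of_nonneg ht.1] at this
        exact mul_le_mul_of_nonneg_left this (norm_nonneg _))
      (show (1 : ℝ) ∈ Set.Icc 0 1 by simp)
    simpa [P] using main

theorem norm_iteratedFDeriv_le_of_flat {f : V → F} (hf : ContDiff ℝ (⊤ : ℕ∞) f) (q n : ℕ) {B : ℝ}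
    (hB : ∀ y, ‖iteratedFDeriv ℝ (n + q) f y‖ ≤ B) {x : V}
    (hx : ∀ k, iteratedFDeriv ℝ k f x = 0) (y : V) :
    ‖iteratedFDeriv ℝ n f y‖ ≤ B * dist y x ^ q / q.factorial := by
  have := norm_iteratedFDeriv_add_le hf q n hB x (y - x)
  simpa [hx, dist_eq_norm] using this

end Taylor

section QuasiAnalytic

/-- The quotients `M_{p+1} / M_p`. -/
noncomputable def quot (Mp : ℕ → ℝ) (p : ℕ) : ℝ := Mp (p + 1) / Mp p

variable {Mp : ℕ → ℝ}

theorem quot_pos (hMpos : ∀ p, 0 < Mp p) (p : ℕ) : 0 < quot Mp p :=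
  div_pos (hMpos _) (hMpos _)

theorem monotone_quot (hMpos : ∀ p, 0 < Mp p) (hM1 : CondM1 Mp) : Monotone (quot Mp) := by
  refine monotone_nat_of_le_succ fun p => ?_
  unfold quot
  rw [div_le_div_iff₀ (hMpos _) (hMpos _)]
  have := hM1 p
  nlinarith

theorem add_eq_mul_prod_quot (hMpos : ∀ p, 0 < Mp p) (n i : ℕ) :
    Mp (n + i) = Mp n * ∏ j ∈ Finset.range i, quot Mp (n + j) := by
  induction i with
  | zero => simp
  | succ i ih =>
    rw [Finset.prod_range_succ, ← mul_assoc, ← ih, quot, ← add_assoc,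
      mul_div_cancel₀ _ (hMpos _).ne']

theorem add_le_mul_quot_pow (hMpos : ∀ p, 0 < Mp p) (hM1 : CondM1 Mp) {n i N : ℕ}
    (h : n + i ≤ N + 1) : Mp (n + i) ≤ Mp n * quot Mp N ^ i := by
  rw [add_eq_mul_prod_quot hMpos]
  refine mul_le_mul_of_nonneg_left ?_ (hMpos n).le
  calc ∏ j ∈ Finset.range i, quot Mp (n + j) ≤ ∏ _j ∈ Finset.range i, quot Mp N := by
        refine Finset.prod_le_prod (fun j _ => (quot_pos hMpos _).le) fun j hj => ?_
        have := Finset.mem_range.1 hj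
        exact monotone_quot hMpos hM1 (by omega)
    _ = _ := by simp

variable {V F : Type*} [NormedAddCommGroup V] [NormedSpace ℝ V] [NormedAddCommGroup F]
  [NormedSpace ℝ F]

/-- One step of Bang's argument: the bound `e^{-(N+1)}` on the normalized jet grows at most to
`e^{-N}` over a distance `1 / (e m_N)`. -/
theorem bang_step (hMpos : ∀ p, 0 < Mp p) (hM1 : CondM1 Mp) {f : V → F}
    (hf : ContDiff ℝ (⊤ : ℕ∞) f) (hb : ∀ n x, ‖iteratedFDeriv ℝ n f x‖ ≤ Mp n) (N : ℕ) {x y : V}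
    (hx : ∀ n, ‖iteratedFDeriv ℝ n f x‖ ≤ Real.exp (-(N + 1 : ℕ)) * Real.exp n * Mp n)
    (hxy : dist y x ≤ 1 / (Real.exp 1 * quot Mp N)) (n : ℕ) :
    ‖iteratedFDeriv ℝ n f y‖ ≤ Real.exp (-(N : ℕ)) * Real.exp n * Mp n := by
  have hq := quot_pos hMpos N
  by_cases hn : N + 1 ≤ n
  · refine (hb n y).trans ?_
    rw [← Real.exp_add]
    refine le_mul_of_one_le_left (hMpos n).le (Real.one_le_exp ?_)
    have : (N : ℝ) + 1 ≤ n := by exact_mod_cast hn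
    linarith
  · obtain ⟨q, hq'⟩ : ∃ q, n + q = N + 1 := ⟨N + 1 - n, by omega⟩
    have h1 := norm_iteratedFDeriv_add_le hf q n (fun z => hb (n + q) z) x (y - x)
    rw [add_sub_cancel] at h1
    refine h1.trans ?_
    rw [← dist_eq_norm]
    set C := Real.exp (-(N + 1 : ℕ)) * Real.exp n * Mp n with hC
    have hCpos : 0 ≤ C := by have := hMpos n; positivity
    have hz : Real.exp 1 * quot Mp N * dist y x ≤ 1 := by
      rwa [le_div_iff₀ (by positivity), mul_comm] at hxy
    have hterm : ∀ i, n + i ≤ N + 1 →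
        Real.exp (-(N + 1 : ℕ)) * Real.exp (n + i : ℕ) * Mp (n + i) * dist y x ^ i ≤ C := by
      intro i hi
      calc Real.exp (-(N + 1 : ℕ)) * Real.exp (n + i : ℕ) * Mp (n + i) * dist y x ^ i
          ≤ Real.exp (-(N + 1 : ℕ)) * Real.exp (n + i : ℕ) * (Mp n * quot Mp N ^ i) *
              dist y x ^ i := by
            gcongr
            exact add_le_mul_quot_pow hMpos hM1 hi
        _ = C * (Real.exp 1 * quot Mp N * dist y x) ^ i := by
            have e : Real.exp (n + i : ℕ) = Real.exp n * Real.exp i := by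
              rw [← Real.exp_add, Nat.cast_add]
            rw [hC, mul_pow, mul_pow, ← Real.exp_nat_mul, e, mul_one]
            ring
        _ ≤ C * 1 := by
            gcongr
            exact pow_le_one₀ (by positivity) hz
        _ = C := mul_one _
    have h2 : ∑ i ∈ Finset.range q, ‖iteratedFDeriv ℝ (n + i) f x‖ * dist y x ^ i / i.factorial +
        Mp (n + q) * dist y x ^ q / q.factorial ≤
        ∑ i ∈ Finset.range (q + 1), C / i.factorial := by
      rw [Finset.sum_range_succ]
      refine add_le_add (Finset.sum_le_sum fun i hi => ?_) ?_
      · have := Finset.mem_range.1 hi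
        gcongr
        refine le_trans ?_ (hterm i (by omega))
        gcongr
        exact hx (n + i)
      · gcongr
        refine le_trans (le_of_eq ?_) (hterm q hq'.le)
        rw [hq', ← Real.exp_add]
        simp
    refine h2.trans ?_
    calc ∑ i ∈ Finset.range (q + 1), C / i.factorial
        = C * ∑ i ∈ Finset.range (q + 1), (1 : ℝ) ^ i / i.factorial := by
          rw [Finset.mul_sum]
          simp [div_eq_mul_inv]
      _ ≤ C * Real.exp 1 := by
          gcongr
          exact Real.sum_le_exp_of_nonneg zero_le_one _
      _ = _ := by
          have : Real.exp (-(N : ℕ) : ℝ) = Real.exp (-(N + 1 : ℕ) : ℝ) * Real.exp 1 := by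
            rw [← Real.exp_add]
            push_cast
            ring_nf
          rw [hC, this]
          ring

/-- The Denjoy–Carleman theorem: if `∑ M_p / M_{p+1}` diverges, a function in the class of
`(M_p)` which is flat at one point vanishes. -/
theorem eq_zero_of_not_summable (hMpos : ∀ p, 0 < Mp p) (hM1 : CondM1 Mp)
    (hns : ¬ Summable fun p => (quot Mp p)⁻¹) {f : V → F}
    (hf : ContDiff ℝ (⊤ : ℕ∞) f) (hb : ∀ n x, ‖iteratedFDeriv ℝ n f x‖ ≤ Mp n) {x₀ : V}
    (hx₀ : ∀ n, iteratedFDeriv ℝ n f x₀ = 0) (y : V) : f y = 0 := by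
  have hq := quot_pos hMpos
  have key : ∀ (k N : ℕ) (z : V),
      dist z x₀ ≤ ∑ j ∈ Finset.range k, 1 / (Real.exp 1 * quot Mp (N + j)) →
      ∀ n, ‖iteratedFDeriv ℝ n f z‖ ≤ Real.exp (-(N : ℕ)) * Real.exp n * Mp n := by
    intro k
    induction k with
    | zero =>
      intro N z hz n
      have : z = x₀ := by simpa using hz
      rw [this, hx₀, norm_zero]
      have := hMpos n
      positivity
    | succ k ih =>
      intro N z hz
      rw [Finset.sum_range_succ'] at hz
      set a := 1 / (Real.exp 1 * quot Mp N) with ha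
      set b := ∑ j ∈ Finset.range k, 1 / (Real.exp 1 * quot Mp (N + 1 + j)) with hb'
      have hsum : dist z x₀ ≤ a + b := by
        refine hz.trans (le_of_eq ?_)
        rw [add_comm, ha, hb']
        congr 1
        refine Finset.sum_congr rfl fun j _ => ?_
        rw [show N + (j + 1) = N + 1 + j by ring]
      have hapos : 0 < a := by have := hq N; positivity
      have hbnn : 0 ≤ b := Finset.sum_nonneg fun j _ => by have := hq (N + 1 + j); positivity
      have hab : 0 < a + b := by linarith
      set w : V := x₀ + (b / (a + b)) • (z - x₀) with hw
      have h1 : dist w x₀ ≤ b := by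
        rw [dist_eq_norm, hw, add_sub_cancel_left, norm_smul, Real.norm_of_nonneg (by positivity),
          ← dist_eq_norm]
        calc b / (a + b) * dist z x₀ ≤ b / (a + b) * (a + b) := by gcongr
          _ = b := by field_simp
      have h2 : dist z w ≤ a := by
        have : z - w = (a / (a + b)) • (z - x₀) := by
          have e : a / (a + b) = 1 - b / (a + b) := by field_simp; ring
          rw [hw, e, sub_smul, one_smul]
          abel
        rw [dist_eq_norm, this, norm_smul, Real.norm_of_nonneg (by positivity), ← dist_eq_norm]
        calc a / (a + b) * dist z x₀ ≤ a / (a + b) * (a + b) := by gcongr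
          _ = a := by field_simp
      exact bang_step hMpos hM1 hf hb N (ih (N + 1) w h1) h2
  have hall : ∀ N : ℕ, ‖f y‖ ≤ Real.exp (-(N : ℕ)) * Mp 0 := by
    intro N
    have hns' : ¬ Summable fun j => 1 / (Real.exp 1 * quot Mp (N + j)) := by
      intro h
      apply hns
      have h1 : Summable fun j => (quot Mp (j + N))⁻¹ := by
        refine (h.mul_left (Real.exp 1)).congr fun j => ?_
        have := hq (N + j)
        rw [add_comm j N]
        field_simp
      exact (summable_nat_add_iff N).1 h1
    have htop := not_summable_iff_tendsto_nat_atTop_of_nonneg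
      (fun j => by have := hq (N + j); positivity) |>.1 hns'
    obtain ⟨k, hk⟩ := (htop.eventually_ge_atTop (dist y x₀)).exists
    simpa using key k N y hk 0
  have hlim : Filter.Tendsto (fun N : ℕ => Real.exp (-(N : ℕ)) * Mp 0) Filter.atTop (nhds 0) := by
    have h1 : Filter.Tendsto (fun N : ℕ => Real.exp (-(N : ℝ))) Filter.atTop (nhds 0) :=
      Real.tendsto_exp_neg_atTop_nhds_zero.comp tendsto_natCast_atTop_atTop
    simpa using h1.mul_const (Mp 0)
  have := ge_of_tendsto' hlim hall
  exact norm_le_zero_iff.1 this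

end QuasiAnalytic

section SmoothingMeasure

open MeasureTheory ProbabilityTheory

/-- A bounded jet on the line: a sequence of bounded functions, each of which is the derivative of
the preceding one. -/
structure IsBoundedJet (w : ℕ → ℝ → ℂ) : Prop where
  hasDerivAt : ∀ n t, HasDerivAt (w n) (w (n + 1) t) t
  bounded : ∀ n, ∃ C, ∀ t, ‖w n t‖ ≤ C

theorem IsBoundedJet.continuous {w : ℕ → ℝ → ℂ} (hw : IsBoundedJet w) (n : ℕ) :
    Continuous (w n) :=
  continuous_iff_continuousAt.2 fun t => (hw.hasDerivAt n t).continuousAt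

/-- The symmetric difference quotient of a bounded jet. -/
noncomputable def jetDiff (a : ℝ) (w : ℕ → ℝ → ℂ) (n : ℕ) (t : ℝ) : ℂ :=
  ((2 * a)⁻¹ : ℝ) • (w n (t + a) - w n (t - a))

theorem norm_jetDiff_le {a : ℝ} (ha : 0 < a) {w : ℕ → ℝ → ℂ} {n : ℕ} {C : ℝ}
    (hC : ∀ t, ‖w n t‖ ≤ C) (t : ℝ) : ‖jetDiff a w n t‖ ≤ a⁻¹ * C := by
  rw [jetDiff, norm_smul, Real.norm_of_nonneg (by positivity)]
  calc (2 * a)⁻¹ * ‖w n (t + a) - w n (t - a)‖ ≤ (2 * a)⁻¹ * (C + C) := by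
        gcongr
        exact (norm_sub_le _ _).trans (add_le_add (hC _) (hC _))
    _ = a⁻¹ * C := by field_simp; ring

theorem IsBoundedJet.jetDiff {w : ℕ → ℝ → ℂ} (hw : IsBoundedJet w) {a : ℝ} (ha : 0 < a) :
    IsBoundedJet (jetDiff a w) where
  hasDerivAt n t :=
    (((hw.hasDerivAt n (t + a)).comp_add_const t a).sub
      ((hw.hasDerivAt n (t - a)).comp_sub_const t a)).const_smul ((2 * a)⁻¹ : ℝ)
  bounded n := by
    obtain ⟨C, hC⟩ := hw.bounded n
    exact ⟨a⁻¹ * C, norm_jetDiff_le ha hC⟩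

theorem integral_unitInterval_jet {w : ℕ → ℝ → ℂ} (hw : IsBoundedJet w) {a : ℝ} (ha : 0 < a)
    (n : ℕ) (s : ℝ) :
    ∫ i : unitInterval, w (n + 1) (s + a * (2 * (i : ℝ) - 1)) = jetDiff a w n s := by
  have h1 : ∫ i : unitInterval, w (n + 1) (s + a * (2 * (i : ℝ) - 1)) =
      ∫ x in (0 : ℝ)..1, w (n + 1) (s + a * (2 * x - 1)) := by
    rw [intervalIntegral.integral_of_le zero_le_one, ← integral_Icc_eq_integral_Ioc]
    exact integral_subtype_comap (s := Set.Icc (0 : ℝ) 1) measurableSet_Icc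
      (fun x : ℝ => w (n + 1) (s + a * (2 * x - 1)))
  have h2 : ∀ x : ℝ, HasDerivAt (fun x : ℝ => ((2 * a)⁻¹ : ℝ) • w n (s + a * (2 * x - 1)))
      (w (n + 1) (s + a * (2 * x - 1))) x := by
    intro x
    have hl : HasDerivAt (fun x : ℝ => s + a * (2 * x - 1)) (a * (2 * 1)) x :=
      ((((hasDerivAt_id x).const_mul 2).sub_const 1).const_mul a).const_add s
    have h := ((hw.hasDerivAt n _).scomp x hl).const_smul ((2 * a)⁻¹ : ℝ)
    refine h.congr_deriv ?_
    rw [smul_smul]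
    have : (2 * a)⁻¹ * (a * (2 * 1)) = 1 := by field_simp
    rw [this, one_smul]
  rw [h1, intervalIntegral.integral_eq_sub_of_hasDerivAt (fun x _ => h2 x)
    ((hw.continuous (n + 1)).comp (by fun_prop) |>.intervalIntegrable _ _), jetDiff, ← smul_sub]
  congr 3 <;> ring_nf

variable (a : ℕ → ℝ)

/-- A uniformly distributed random variable on `[-a j, a j]`. -/
noncomputable def unifVar (j : ℕ) (ω : ℕ → unitInterval) : ℝ := a j * (2 * (ω j : ℝ) - 1)

theorem measurable_unifVar (j : ℕ) : Measurable (unifVar a j) := by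
  unfold unifVar
  fun_prop

variable {a}

theorem abs_unifVar_le (ha : ∀ j, 0 < a j) (j : ℕ) (ω : ℕ → unitInterval) :
    |unifVar a j ω| ≤ a j := by
  rw [unifVar, abs_mul, abs_of_pos (ha j)]
  refine mul_le_of_le_one_right (ha j).le ?_
  have h0 := (ω j).2.1
  have h1 := (ω j).2.2
  rw [abs_le]
  constructor <;> linarith

/-- The product of the uniform measures on the unit interval. -/
noncomputable def unifMeasure : Measure (ℕ → unitInterval) :=
  Measure.infinitePi fun _ => volume

instance : IsProbabilityMeasure unifMeasure := by
  unfold unifMeasure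
  infer_instance

theorem iIndepFun_unifVar (a : ℕ → ℝ) : iIndepFun (unifVar a) unifMeasure := by
  have := iIndepFun_infinitePi (P := fun _ : ℕ => (volume : Measure unitInterval))
    (X := fun j (x : unitInterval) => a j * (2 * (x : ℝ) - 1)) (fun j => by fun_prop)
  exact this

theorem norm_integral_finset_sum_unifVar_le (ha : ∀ j, 0 < a j) (n : ℕ) :
    ∀ (s : Finset ℕ), Finset.range n ⊆ s → ∀ w : ℕ → ℝ → ℂ, IsBoundedJet w →
      ∀ B : ℝ, (∀ t, ‖w 0 t‖ ≤ B) →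
      ‖∫ ω, w n (∑ j ∈ s, unifVar a j ω) ∂unifMeasure‖ ≤
        (∏ j ∈ Finset.range n, (a j)⁻¹) * B := by
  induction n with
  | zero =>
    intro s _ w hw B hB
    have := norm_integral_le_of_norm_le_const (μ := unifMeasure)
      (f := fun ω => w 0 (∑ j ∈ s, unifVar a j ω)) (Filter.Eventually.of_forall fun ω => hB _)
    simpa using this
  | succ n ih =>
    intro s hs w hw B hB
    have hns : n ∈ s := hs (by simp)
    have hrange : Finset.range n ⊆ s.erase n := by
      intro j hj
      have hj' := Finset.mem_range.1 hj
      exact Finset.mem_erase.2 ⟨hj'.ne, hs (Finset.mem_range.2 (by omega))⟩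
    set S : (ℕ → unitInterval) → ℝ := fun ω => ∑ j ∈ s.erase n, unifVar a j ω with hS
    have hSm : Measurable S := Finset.measurable_fun_sum _ fun j _ => measurable_unifVar a j
    have hind : IndepFun S (unifVar a n) unifMeasure := by
      have := (iIndepFun_unifVar a).indepFun_finsetSum_of_notMem (measurable_unifVar a)
        (s := s.erase n) (i := n) (by simp)
      convert this using 1
      ext ω
      simp [hS]
    have hmap := (indepFun_iff_map_prod_eq_prod_map_map hSm.aemeasurable
      (measurable_unifVar a n).aemeasurable).1 hind
    have : IsProbabilityMeasure (unifMeasure.map S) :=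
      Measure.isProbabilityMeasure_map hSm.aemeasurable
    have : IsProbabilityMeasure (unifMeasure.map (unifVar a n)) :=
      Measure.isProbabilityMeasure_map (measurable_unifVar a n).aemeasurable
    have hcont : Continuous fun p : ℝ × ℝ => w (n + 1) (p.1 + p.2) :=
      (hw.continuous _).comp (by fun_prop)
    obtain ⟨C, hC⟩ := hw.bounded (n + 1)
    have h_int : ∫ ω, w (n + 1) (∑ j ∈ s, unifVar a j ω) ∂unifMeasure =
        ∫ ω, jetDiff (a n) w n (S ω) ∂unifMeasure := by
      have e1 : ∀ ω, ∑ j ∈ s, unifVar a j ω = S ω + unifVar a n ω := by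
        intro ω
        rw [hS]
        exact (Finset.sum_erase_add _ _ hns).symm
      have e2 : ∫ ω, w (n + 1) (S ω + unifVar a n ω) ∂unifMeasure =
          ∫ p, w (n + 1) (p.1 + p.2)
            ∂((unifMeasure.map S).prod (unifMeasure.map (unifVar a n))) := by
        rw [← hmap, integral_map (hSm.prodMk (measurable_unifVar a n)).aemeasurable
          hcont.aestronglyMeasurable]
      have e3 : ∀ x : ℝ, ∫ y, w (n + 1) (x + y) ∂(unifMeasure.map (unifVar a n)) =
          jetDiff (a n) w n x := by
        intro x
        have hcx : Continuous fun y : ℝ => w (n + 1) (x + y) :=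
          (hw.continuous (n + 1)).comp (by fun_prop)
        rw [integral_map (measurable_unifVar a n).aemeasurable hcx.aestronglyMeasurable,
          ← integral_unitInterval_jet hw (ha n) n x]
        have hmp := measurePreserving_eval_infinitePi
          (fun _ : ℕ => (volume : Measure unitInterval)) n
        have hc : Continuous fun i : unitInterval => w (n + 1) (x + a n * (2 * (i : ℝ) - 1)) :=
          (hw.continuous (n + 1)).comp (by fun_prop)
        rw [← hmp.map_eq, integral_map hmp.measurable.aemeasurable
          hc.aestronglyMeasurable]
        rfl
      simp_rw [e1]
      rw [e2, integral_prod]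
      · simp_rw [e3]
        rw [integral_map hSm.aemeasurable
          ((hw.jetDiff (ha n)).continuous n).aestronglyMeasurable]
      · exact Integrable.of_bound hcont.aestronglyMeasurable C
          (Filter.Eventually.of_forall fun p => hC _)
    rw [h_int, Finset.prod_range_succ, mul_assoc]
    exact ih _ hrange _ (hw.jetDiff (ha n)) _ (norm_jetDiff_le (ha n) hB)

/-- The law of a sum of independent uniform variables on `[-a j, a j]`. -/
theorem exists_smoothing_measure (ha : ∀ j, 0 < a j) (hs : Summable a) :
    ∃ m : Measure ℝ, IsProbabilityMeasure m ∧ (∀ᵐ t ∂m, |t| ≤ ∑' j, a j) ∧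
      ∀ w : ℕ → ℝ → ℂ, IsBoundedJet w → ∀ B : ℝ, (∀ t, ‖w 0 t‖ ≤ B) → ∀ n,
        ‖∫ t, w n t ∂m‖ ≤ (∏ j ∈ Finset.range n, (a j)⁻¹) * B := by
  have hsum : ∀ ω, Summable fun j => unifVar a j ω := fun ω =>
    Summable.of_norm_bounded (f := fun j => unifVar a j ω) hs fun j => abs_unifVar_le ha j ω
  set S : (ℕ → unitInterval) → ℝ := fun ω => ∑' j, unifVar a j ω with hS
  have hlim : ∀ ω, Filter.Tendsto (fun N => ∑ j ∈ Finset.range N, unifVar a j ω)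
      Filter.atTop (nhds (S ω)) := fun ω => (hsum ω).hasSum.tendsto_sum_nat
  have hSm : Measurable S := measurable_of_tendsto_metrizable
    (fun N => Finset.measurable_fun_sum (Finset.range N) fun j _ => measurable_unifVar a j)
    (tendsto_pi_nhds.2 hlim)
  refine ⟨unifMeasure.map S, Measure.isProbabilityMeasure_map hSm.aemeasurable, ?_, ?_⟩
  · rw [ae_map_iff hSm.aemeasurable (measurableSet_le (by fun_prop) (by fun_prop))]
    refine Filter.Eventually.of_forall fun ω => ?_
    exact tsum_of_norm_bounded (f := fun j => unifVar a j ω) hs.hasSum fun j => abs_unifVar_le ha j ω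
  · intro w hw B hB n
    obtain ⟨C, hC⟩ := hw.bounded n
    rw [integral_map hSm.aemeasurable (hw.continuous n).aestronglyMeasurable]
    have htend : Filter.Tendsto
        (fun N => ∫ ω, w n (∑ j ∈ Finset.range N, unifVar a j ω) ∂unifMeasure) Filter.atTop
        (nhds (∫ ω, w n (S ω) ∂unifMeasure)) := by
      refine tendsto_integral_of_dominated_convergence (fun _ => C) (fun N => ?_)
        (integrable_const C) (fun N => Filter.Eventually.of_forall fun ω => hC _)
        (Filter.Eventually.of_forall fun ω => ((hw.continuous n).tendsto _).comp (hlim ω))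
      exact ((hw.continuous n).measurable.comp (Finset.measurable_fun_sum (Finset.range N)
        fun j _ => measurable_unifVar a j)).aestronglyMeasurable
    refine le_of_tendsto htend.norm ?_
    filter_upwards [Filter.eventually_ge_atTop n] with N hN
    exact norm_integral_finset_sum_unifVar_le ha n _
      (Finset.range_subset_range.2 hN) w hw B hB

end SmoothingMeasure

section SmoothingOperator

open MeasureTheory

variable {d : ℕ}

theorem norm_single_one (j : Fin d) : ‖(EuclideanSpace.single j (1 : ℝ) : Euc d)‖ = 1 := by
  simp

theorem hasCompactSupport_pderiv1 (j : Fin d) {u : Euc d → ℂ} (hu : HasCompactSupport u) :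
    HasCompactSupport (pderiv1 j u) :=
  hu.fderiv_apply (𝕜 := ℝ) _

theorem hasCompactSupport_lderiv (l : List (Fin d)) {u : Euc d → ℂ} (hu : HasCompactSupport u) :
    HasCompactSupport (lderiv l u) := by
  induction l with
  | nil => exact hu
  | cons j l ih => exact hasCompactSupport_pderiv1 j ih

/-- Averaging of a function in the direction of the `j`-th coordinate with respect to `m`. -/
noncomputable def convDir (m : Measure ℝ) (j : Fin d) (u : Euc d → ℂ) : Euc d → ℂ :=
  fun x => ∫ t, u (x - t • EuclideanSpace.single j 1) ∂m

variable {m : Measure ℝ} [IsProbabilityMeasure m] {u : Euc d → ℂ}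

theorem integrable_comp_sub_smul {F : Type*} [NormedAddCommGroup F]
    {u : Euc d → F} (hu : Continuous u) (hc : HasCompactSupport u) (x v : Euc d) :
    Integrable (fun t : ℝ => u (x - t • v)) m := by
  obtain ⟨C, hC⟩ := hc.exists_bound_of_continuous hu
  exact Integrable.of_bound (by fun_prop) C (Filter.Eventually.of_forall fun t => hC _)

theorem contDiff_convDir (j : Fin d) (hu : ContDiff ℝ (⊤ : ℕ∞) u) (hc : HasCompactSupport u) :
    ContDiff ℝ (⊤ : ℕ∞) (convDir m j u) := by
  have hmeas : Measurable fun t : ℝ => t • (EuclideanSpace.single j 1 : Euc d) := by fun_prop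
  have : IsProbabilityMeasure (m.map fun t : ℝ => t • (EuclideanSpace.single j 1 : Euc d)) :=
    Measure.isProbabilityMeasure_map hmeas.aemeasurable
  have h := hc.contDiff_convolution_right (ContinuousLinearMap.lsmul ℝ ℝ : ℝ →L[ℝ] ℂ →L[ℝ] ℂ)
    (f := fun _ : Euc d => (1 : ℝ))
    (μ := m.map fun t : ℝ => t • (EuclideanSpace.single j 1 : Euc d))
    (integrable_const _).locallyIntegrable hu
  convert h using 1
  ext x
  have hcont : Continuous fun y => u (x - y) := hu.continuous.comp (by fun_prop)
  simp only [convDir, convolution, ContinuousLinearMap.lsmul_apply, one_smul]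
  rw [integral_map hmeas.aemeasurable hcont.aestronglyMeasurable]

theorem pderiv1_convDir (i j : Fin d) (hu : ContDiff ℝ (⊤ : ℕ∞) u) (hc : HasCompactSupport u) :
    pderiv1 i (convDir m j u) = convDir m j (pderiv1 i u) := by
  have hf : Continuous (fderiv ℝ u) := hu.continuous_fderiv (by simp)
  have hfc : HasCompactSupport (fderiv ℝ u) := hc.fderiv (𝕜 := ℝ)
  obtain ⟨C, hC⟩ := hfc.exists_bound_of_continuous hf
  ext x
  have hder : HasFDerivAt (convDir m j u)
      (∫ t, fderiv ℝ u (x - t • EuclideanSpace.single j 1) ∂m) x := by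
    refine hasFDerivAt_integral_of_dominated_of_fderiv_le (s := Set.univ) (bound := fun _ => C)
      (F' := fun y t => fderiv ℝ u (y - t • EuclideanSpace.single j 1)) Filter.univ_mem
      (Filter.Eventually.of_forall fun y =>
        (integrable_comp_sub_smul hu.continuous hc y _).aestronglyMeasurable)
      (integrable_comp_sub_smul hu.continuous hc x _)
      (integrable_comp_sub_smul hf hfc x _).aestronglyMeasurable
      (Filter.Eventually.of_forall fun t y _ => hC _) (integrable_const C)
      (Filter.Eventually.of_forall fun t y _ => ?_)
    exact (hasFDerivAt_comp_sub _).2 ((hu.differentiable (by simp)) _).hasFDerivAt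
  rw [pderiv1, hder.fderiv, ContinuousLinearMap.integral_apply
    (integrable_comp_sub_smul hf hfc x _)]
  rfl

theorem lderiv_convDir (l : List (Fin d)) (j : Fin d) (hu : ContDiff ℝ (⊤ : ℕ∞) u)
    (hc : HasCompactSupport u) : lderiv l (convDir m j u) = convDir m j (lderiv l u) := by
  induction l with
  | nil => rfl
  | cons i l ih =>
    change pderiv1 i (lderiv l (convDir m j u)) = convDir m j (pderiv1 i (lderiv l u))
    rw [ih, pderiv1_convDir i j (contDiff_lderiv l hu) (hasCompactSupport_lderiv l hc)]

theorem norm_convDir_sub_le {R : ℝ} (hR : ∀ᵐ t ∂m, |t| ≤ R) (j : Fin d) (hu : Continuous u)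
    (hc : HasCompactSupport u) (x : Euc d) (c : ℂ) {η : ℝ}
    (h : ∀ y, dist y x ≤ R → ‖u y - c‖ ≤ η) : ‖convDir m j u x - c‖ ≤ η := by
  have e : convDir m j u x - c = ∫ t, (u (x - t • EuclideanSpace.single j 1) - c) ∂m := by
    rw [integral_sub (integrable_comp_sub_smul hu hc x _) (integrable_const c)]
    simp [convDir]
  rw [e]
  have := norm_integral_le_of_norm_le_const (μ := m) (C := η)
    (f := fun t => u (x - t • EuclideanSpace.single j 1) - c) (by
      filter_upwards [hR] with t ht
      refine h _ ?_
      rw [dist_eq_norm, sub_sub_cancel_left, norm_neg, norm_smul, norm_single_one, mul_one]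
      exact ht)
  simpa using this

theorem hasCompactSupport_convDir {R : ℝ} (hR : ∀ᵐ t ∂m, |t| ≤ R) (j : Fin d) (hu : Continuous u)
    (hc : HasCompactSupport u) : HasCompactSupport (convDir m j u) := by
  refine HasCompactSupport.of_support_subset_isCompact (hc.isCompact.cthickening (r := R)) ?_
  intro x hx
  by_contra hxn
  apply hx
  refine norm_le_zero_iff.1 ?_
  rw [← sub_zero (convDir m j u x)]
  refine norm_convDir_sub_le hR j hu hc x 0 fun y hy => ?_
  rw [sub_zero, norm_le_zero_iff]
  by_contra hy0
  apply hxn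
  exact Metric.mem_cthickening_of_dist_le x y R _ (subset_tsupport _ hy0) (by rwa [dist_comm])

theorem norm_iterate_pderiv1_convDir_le {P : ℕ → ℝ}
    (hm : ∀ w : ℕ → ℝ → ℂ, IsBoundedJet w → ∀ B : ℝ, (∀ t, ‖w 0 t‖ ≤ B) → ∀ n,
        ‖∫ t, w n t ∂m‖ ≤ P n * B)
    (j : Fin d) (hu : ContDiff ℝ (⊤ : ℕ∞) u) (hc : HasCompactSupport u) {B : ℝ}
    (hB : ∀ x, ‖u x‖ ≤ B) (n : ℕ) (x : Euc d) :
    ‖(pderiv1 j)^[n] (convDir m j u) x‖ ≤ P n * B := by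
  have hsm : ∀ n, ContDiff ℝ (⊤ : ℕ∞) ((pderiv1 j)^[n] u) := fun n => by
    rw [← lderiv_replicate]
    exact contDiff_lderiv _ hu
  have hcs : ∀ n, HasCompactSupport ((pderiv1 j)^[n] u) := fun n => by
    rw [← lderiv_replicate]
    exact hasCompactSupport_lderiv _ hc
  let w : ℕ → ℝ → ℂ := fun n t =>
    (-1) ^ n * (pderiv1 j)^[n] u (x - t • EuclideanSpace.single j 1)
  have hw : IsBoundedJet w := by
    refine ⟨fun n t => ?_, fun n => ?_⟩
    · have hl : HasDerivAt (fun t : ℝ => x - t • (EuclideanSpace.single j 1 : Euc d))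
          (-EuclideanSpace.single j 1) t := by
        simpa using ((hasDerivAt_id t).smul_const
          (EuclideanSpace.single j 1 : Euc d)).const_sub x
      have h1 := (((hsm n).differentiable (by simp)) _).hasFDerivAt.comp_hasDerivAt t hl
      refine (h1.const_mul ((-1 : ℂ) ^ n)).congr_deriv ?_
      simp only [w, Function.iterate_succ_apply', pderiv1, map_neg]
      ring
    · obtain ⟨C, hC⟩ := (hcs n).exists_bound_of_continuous (hsm n).continuous
      exact ⟨C, fun t => by simpa [w] using hC _⟩
  have h := hm w hw B (fun t => by simpa [w] using hB _) n
  rw [← lderiv_replicate, lderiv_convDir _ _ hu hc, lderiv_replicate]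
  simp only [w] at h
  rw [integral_const_mul] at h
  simpa [convDir] using h

/-- Averaging successively in the directions of the coordinates in a list. -/
noncomputable def convList (m : Measure ℝ) (L : List (Fin d)) (u : Euc d → ℂ) : Euc d → ℂ :=
  L.foldr (fun j g => convDir m j g) u

theorem convList_spec {R : ℝ} (hR : ∀ᵐ t ∂m, |t| ≤ R) {P : ℕ → ℝ}
    (hm : ∀ w : ℕ → ℝ → ℂ, IsBoundedJet w → ∀ B : ℝ, (∀ t, ‖w 0 t‖ ≤ B) → ∀ n,
        ‖∫ t, w n t ∂m‖ ≤ P n * B)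
    (hu : ContDiff ℝ (⊤ : ℕ∞) u) (hc : HasCompactSupport u) (L : List (Fin d)) :
    ContDiff ℝ (⊤ : ℕ∞) (convList m L u) ∧ HasCompactSupport (convList m L u) ∧
    (∀ l, lderiv l (convList m L u) = convList m L (lderiv l u)) ∧
    (∀ (x : Euc d) (c : ℂ) (η : ℝ), (∀ y, dist y x ≤ L.length * R → ‖u y - c‖ ≤ η) →
      ‖convList m L u x - c‖ ≤ η) ∧
    (∀ (α : Fin d → ℕ) (B : ℝ), (∀ y, ‖u y‖ ≤ B) → ∀ x,
      ‖lderiv (indexList L α) (convList m L u) x‖ ≤ (L.map fun i => P (α i)).prod * B) := by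
  induction L generalizing u with
  | nil =>
    refine ⟨hu, hc, fun l => rfl, fun x c η h => h x (by simp), fun α B hB x => ?_⟩
    simpa [indexList, lderiv, convList] using hB x
  | cons j L ih =>
    obtain ⟨h1, h2, h3, h4, h5⟩ := ih hu hc
    have e : convList m (j :: L) u = convDir m j (convList m L u) := rfl
    rw [e]
    refine ⟨contDiff_convDir j h1 h2, hasCompactSupport_convDir hR j h1.continuous h2,
      fun l => ?_, fun x c η h => ?_, fun α B hB x => ?_⟩
    · rw [lderiv_convDir l j h1 h2, h3]
      rfl
    · refine norm_convDir_sub_le hR j h1.continuous h2 x c fun y hy => h4 y c η fun z hz => ?_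
      refine h z ((dist_triangle z y x).trans ?_)
      simp only [List.length_cons]
      push_cast
      linarith
    · have e2 : indexList (j :: L) α = List.replicate (α j) j ++ indexList L α := rfl
      rw [e2, lderiv_append, lderiv_convDir _ j h1 h2, lderiv_replicate, List.map_cons,
        List.prod_cons, mul_assoc]
      exact norm_iterate_pderiv1_convDir_le hm j (contDiff_lderiv _ h1)
        (hasCompactSupport_lderiv _ h2) (h5 α B hB) (α j) x

/-- Existence of a regularization operator adapted to a summable sequence of widths. -/
theorem exists_smoothing_operator (d : ℕ) {a : ℕ → ℝ} (ha : ∀ j, 0 < a j) (hs : Summable a) :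
    ∃ Φ : (Euc d → ℂ) → Euc d → ℂ, ∀ u : Euc d → ℂ, ContDiff ℝ (⊤ : ℕ∞) u →
      HasCompactSupport u →
      ContDiff ℝ (⊤ : ℕ∞) (Φ u) ∧
      (∀ (x : Euc d) (c : ℂ) (η : ℝ), (∀ y, dist y x ≤ d * ∑' j, a j → ‖u y - c‖ ≤ η) →
        ‖Φ u x - c‖ ≤ η) ∧
      (∀ (α : Fin d → ℕ) (B : ℝ), (∀ y, ‖u y‖ ≤ B) → ∀ x,
        ‖mderiv α (Φ u) x‖ ≤ (∏ i, ∏ j ∈ Finset.range (α i), (a j)⁻¹) * B) ∧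
      (∀ (α : Fin d → ℕ) (B : ℝ), (∀ y, ‖mderiv α u y‖ ≤ B) → ∀ x,
        ‖mderiv α (Φ u) x‖ ≤ B) := by
  obtain ⟨m, hm1, hm2, hm3⟩ := exists_smoothing_measure ha hs
  refine ⟨convList m (List.finRange d), fun u hu hc => ?_⟩
  obtain ⟨h1, h2, h3, h4, h5⟩ := convList_spec hm2 hm3 hu hc (List.finRange d)
  refine ⟨h1, fun x c η h => h4 x c η (by simpa using h), fun α B hB x => ?_, fun α B hB x => ?_⟩
  · rw [mderiv_eq_lderiv, Fin.prod_univ_def]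
    exact h5 α B hB x
  · have h4' := (convList_spec hm2 hm3 (contDiff_lderiv (indexList (List.finRange d) α) hu)
      (hasCompactSupport_lderiv _ hc) (List.finRange d)).2.2.2.1 x 0 B
    rw [mderiv_eq_lderiv] at hB ⊢
    rw [h3, ← sub_zero (convList m _ _ x)]
    exact h4' fun y _ => by simpa using hB y

end SmoothingOperator

section Sequences

theorem prod_prod_range_le {ι : Type*} (s : Finset ι) (α : ι → ℕ) {b : ℕ → ℝ}
    (hb : ∀ j, 0 ≤ b j) (hm : Monotone b) :
    ∏ i ∈ s, ∏ j ∈ Finset.range (α i), b j ≤ ∏ j ∈ Finset.range (∑ i ∈ s, α i), b j := by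
  classical
  induction s using Finset.induction_on with
  | empty => simp
  | insert i s hi ih =>
    rw [Finset.prod_insert hi, Finset.sum_insert hi, add_comm (α i), Finset.prod_range_add,
      mul_comm]
    refine mul_le_mul ih ?_ (Finset.prod_nonneg fun j _ => hb j)
      (Finset.prod_nonneg fun j _ => hb j)
    exact Finset.prod_le_prod (fun j _ => hb j) fun j _ => hm (by omega)

theorem exists_prod_range_le_pow {c : ℕ → ℝ} (hc : ∀ j, 0 ≤ c j)
    (hlim : Filter.Tendsto c Filter.atTop (nhds 0)) {t : ℝ} (ht : 0 < t) :
    ∃ B, 0 ≤ B ∧ ∀ n, ∏ j ∈ Finset.range n, c j ≤ B * t ^ n := by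
  obtain ⟨N, hN⟩ := Filter.eventually_atTop.1 (hlim.eventually (ge_mem_nhds ht))
  have hpos : ∀ n, 0 ≤ ∏ j ∈ Finset.range n, c j := fun n => Finset.prod_nonneg fun j _ => hc j
  refine ⟨∑ i ∈ Finset.range (N + 1), (∏ j ∈ Finset.range i, c j) / t ^ i,
    Finset.sum_nonneg fun i _ => div_nonneg (hpos i) (by positivity), fun n => ?_⟩
  have hsingle : ∀ i ≤ N, (∏ j ∈ Finset.range i, c j) / t ^ i ≤
      ∑ i ∈ Finset.range (N + 1), (∏ j ∈ Finset.range i, c j) / t ^ i := fun i hi =>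
    Finset.single_le_sum (f := fun i => (∏ j ∈ Finset.range i, c j) / t ^ i)
      (fun i _ => div_nonneg (hpos i) (by positivity)) (Finset.mem_range.2 (by omega))
  rw [← div_le_iff₀ (by positivity)]
  rcases le_total n N with h | h
  · exact hsingle n h
  · induction n, h using Nat.le_induction with
    | base => exact hsingle N le_rfl
    | succ n hn ih =>
      refine le_trans ?_ ih
      rw [Finset.prod_range_succ, pow_succ, div_le_div_iff₀ (by positivity) (by positivity)]
      have := mul_le_mul_of_nonneg_left (hN n hn)
        (mul_nonneg (hpos n) (pow_nonneg ht.le n))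
      nlinarith

theorem exists_summable_ratio_tendsto_zero {b : ℕ → ℝ} (hb : ∀ j, 0 < b j) (hs : Summable b) :
    ∃ a : ℕ → ℝ, (∀ j, 0 < a j) ∧ Summable a ∧
      Filter.Tendsto (fun j => b j / a j) Filter.atTop (nhds 0) := by
  set t : ℕ → ℝ := fun j => ∑' i, b (i + j) with ht
  have hsj : ∀ j, Summable fun i => b (i + j) := fun j => (summable_nat_add_iff j).2 hs
  have htpos : ∀ j, 0 < t j := fun j => (hsj j).tsum_pos (fun i => (hb _).le) 0 (hb _)
  have hstep : ∀ j, t j = b j + t (j + 1) := fun j => by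
    simp only [ht]
    rw [(hsj j).tsum_eq_zero_add, zero_add]
    congr 1
    exact tsum_congr fun i => by congr 1; ring
  have hlt : ∀ j, t (j + 1) < t j := fun j => by linarith [hstep j, hb j]
  have hsq : ∀ j, 0 < √(t j) - √(t (j + 1)) := fun j =>
    sub_pos.2 (Real.sqrt_lt_sqrt (htpos _).le (hlt j))
  refine ⟨fun j => √(t j) - √(t (j + 1)), hsq, ?_, ?_⟩
  · refine summable_of_sum_range_le (c := √(t 0)) (fun j => (hsq j).le) fun n => ?_
    rw [Finset.sum_range_sub' (fun j => √(t j))]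
    linarith [Real.sqrt_nonneg (t n)]
  · have h0 : Filter.Tendsto (fun j => √(t j)) Filter.atTop (nhds 0) := by
      have := (Real.continuous_sqrt.tendsto 0).comp (tendsto_sum_nat_add b)
      simpa [Function.comp_def, ht] using this
    have h1 := h0.add (h0.comp (Filter.tendsto_add_atTop_nat 1))
    rw [add_zero] at h1
    refine h1.congr fun j => ?_
    rw [eq_div_iff (hsq j).ne']
    have e1 := Real.sq_sqrt (htpos j).le
    have e2 := Real.sq_sqrt (htpos (j + 1)).le
    simp only [Function.comp]
    nlinarith [hstep j]

theorem tendsto_mul_of_antitone_summable {b : ℕ → ℝ} (hb : ∀ j, 0 ≤ b j) (hm : Antitone b)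
    (hs : Summable b) : Filter.Tendsto (fun p : ℕ => p * b p) Filter.atTop (nhds 0) := by
  have h0 := (tendsto_sum_nat_add b).comp (Nat.tendsto_div_const_atTop (n := 2) (by norm_num))
  have h1 := h0.const_mul 2
  rw [mul_zero] at h1
  refine squeeze_zero (fun p => mul_nonneg (by positivity) (hb p)) (fun p => ?_) h1
  have hsj : Summable fun i => b (i + p / 2) := (summable_nat_add_iff (p / 2)).2 hs
  have h2 := hsj.sum_le_tsum (Finset.range (p - p / 2)) fun i _ => hb _
  have h3 : ∑ _i ∈ Finset.range (p - p / 2), b p ≤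
      ∑ i ∈ Finset.range (p - p / 2), b (i + p / 2) :=
    Finset.sum_le_sum fun i hi => hm (by have := Finset.mem_range.1 hi; omega)
  rw [Finset.sum_const, Finset.card_range, nsmul_eq_mul] at h3
  have h4 : (p : ℝ) ≤ 2 * ((p - p / 2 : ℕ) : ℝ) := by
    have : p ≤ 2 * (p - p / 2) := by omega
    exact_mod_cast this
  have h5 := mul_le_mul_of_nonneg_right h4 (hb p)
  simp only [Function.comp]
  linarith

variable {Mp : ℕ → ℝ}

theorem eq_prod_quot (hMpos : ∀ p, 0 < Mp p) (hM0 : Mp 0 = 1) (n : ℕ) :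
    Mp n = ∏ j ∈ Finset.range n, quot Mp j := by
  have := add_eq_mul_prod_quot hMpos 0 n
  simpa [hM0] using this

theorem mul_le_add (hMpos : ∀ p, 0 < Mp p) (hM0 : Mp 0 = 1) (hM1 : CondM1 Mp) (n i : ℕ) :
    Mp n * Mp i ≤ Mp (n + i) := by
  rw [add_eq_mul_prod_quot hMpos, eq_prod_quot hMpos hM0 i]
  refine mul_le_mul_of_nonneg_left ?_ (hMpos n).le
  exact Finset.prod_le_prod (fun j _ => (quot_pos hMpos j).le) fun j _ =>
    monotone_quot hMpos hM1 (by omega)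

theorem prod_quot_max_le (hMpos : ∀ p, 0 < Mp p) (hM1 : CondM1 Mp) (p n : ℕ) :
    ∏ j ∈ Finset.range n, quot Mp (max j p) ≤ Mp n * (quot Mp p ^ p / Mp p) := by
  rw [← mul_div_assoc, le_div_iff₀ (hMpos p)]
  have hq := quot_pos hMpos
  have hle : ∀ n ≤ p, ∏ j ∈ Finset.range n, quot Mp (max j p) = quot Mp p ^ n := by
    intro n hn
    rw [Finset.prod_congr rfl (g := fun _ => quot Mp p)]
    · simp
    · intro j hj
      rw [max_eq_right]
      have := Finset.mem_range.1 hj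
      omega
  rcases le_total n p with h | h
  · obtain ⟨i, rfl⟩ := Nat.exists_eq_add_of_le h
    rw [hle n h]
    have := mul_le_mul_of_nonneg_left
      (add_le_mul_quot_pow hMpos hM1 (n := n) (i := i) (N := n + i) (by omega))
      (pow_nonneg (hq (n + i)).le n)
    rw [pow_add]
    linarith
  · obtain ⟨i, rfl⟩ := Nat.exists_eq_add_of_le h
    rw [Finset.prod_range_add, hle p le_rfl, add_eq_mul_prod_quot hMpos p i]
    refine le_of_eq ?_
    rw [Finset.prod_congr rfl (g := fun j => quot Mp (p + j)) fun j _ => by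
      rw [max_eq_left (by omega)]]
    ring

theorem summable_quot_max (hs : Summable fun p => (quot Mp p)⁻¹) (p : ℕ) :
    Summable fun j => (quot Mp (max j p))⁻¹ := by
  rw [← summable_nat_add_iff p]
  refine ((summable_nat_add_iff p).2 hs).congr fun j => ?_
  rw [max_eq_left (by omega)]

theorem tsum_quot_max_le {c0 : ℝ} (hc0 : 1 ≤ c0)
    (hM3 : ∀ p : ℕ, 1 ≤ p →
      ∑' n : ℕ, Mp (p + n) / Mp (p + n + 1) ≤ c0 * p * Mp p / Mp (p + 1))
    (hMpos : ∀ p, 0 < Mp p) (hs : Summable fun p => (quot Mp p)⁻¹) {p : ℕ} (hp : 1 ≤ p) :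
    ∑' j, (quot Mp (max j p))⁻¹ ≤ 2 * c0 * (p * (quot Mp p)⁻¹) := by
  rw [← (summable_quot_max hs p).sum_add_tsum_nat_add p]
  have h1 : ∑ j ∈ Finset.range p, (quot Mp (max j p))⁻¹ = p * (quot Mp p)⁻¹ := by
    rw [Finset.sum_congr rfl (g := fun _ => (quot Mp p)⁻¹)]
    · simp
    · intro j hj
      rw [max_eq_right (Finset.mem_range.1 hj).le]
  have h2 : ∑' j, (quot Mp (max (j + p) p))⁻¹ ≤ c0 * (p * (quot Mp p)⁻¹) := by
    refine le_trans (le_of_eq (tsum_congr fun j => ?_)) ((hM3 p hp).trans (le_of_eq ?_))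
    · rw [max_eq_left (by omega), quot, inv_div, add_comm j p]
    · rw [quot, inv_div]; ring
  rw [h1]
  have := mul_nonneg (Nat.cast_nonneg (α := ℝ) p) (inv_nonneg.2 (quot_pos hMpos p).le)
  nlinarith

end Sequences

section Approximation

variable {d : ℕ}

/-- Smooth functions supported in `K` of Beurling class `(M_p)`. -/
def IsTestFunction (Mp : ℕ → ℝ) (K : Set (Euc d)) (κ : Euc d → ℂ) : Prop :=
  ContDiff ℝ (⊤ : ℕ∞) κ ∧ tsupport κ ⊆ K ∧
    ∀ t : ℝ, 0 < t → ∃ B : ℝ, ∀ (n : ℕ) (x : Euc d), ‖iteratedFDeriv ℝ n κ x‖ ≤ B * t ^ n * Mp n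

theorem iteratedFDeriv_eq_zero_of_notMem {K : Set (Euc d)} {g : Euc d → ℂ} (hg : tsupport g ⊆ K)
    {x : Euc d} (hx : x ∉ K) (n : ℕ) : iteratedFDeriv ℝ n g x = 0 := by
  by_contra h
  exact hx (hg (support_iteratedFDeriv_subset (𝕜 := ℝ) n (Function.mem_support.2 h)))

theorem nonempty_compl_of_isCompact (hd : 0 < d) {K : Set (Euc d)} (hK : IsCompact K) :
    Kᶜ.Nonempty := by
  have : Nonempty (Fin d) := ⟨⟨0, hd⟩⟩
  rw [Set.nonempty_compl]
  rintro rfl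
  exact (noncompact_univ (Euc d)) hK

theorem tsupport_subset_of_infDist {K : Set (Euc d)} {g : Euc d → ℂ} {r : ℝ}
    (hr : 0 < r) (hg : ∀ x, Metric.infDist x Kᶜ < r → g x = 0) : tsupport g ⊆ K := by
  have hcl : IsClosed {x : Euc d | r ≤ Metric.infDist x Kᶜ} :=
    isClosed_le continuous_const (Metric.continuous_infDist_pt _)
  have h1 : tsupport g ⊆ {x : Euc d | r ≤ Metric.infDist x Kᶜ} :=
    closure_minimal (fun x hx => not_lt.1 fun h => hx (hg x h)) hcl
  intro x hx
  by_contra hxK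
  have h2 : r ≤ Metric.infDist x Kᶜ := h1 hx
  rw [Metric.infDist_zero_of_mem (show x ∈ Kᶜ from hxK)] at h2
  linarith

theorem exists_smooth_step {K : Set (Euc d)} {r s : ℝ} (hrs : r < s) :
    ∃ u : Euc d → ℂ, ContDiff ℝ (⊤ : ℕ∞) u ∧ (∀ x, Metric.infDist x Kᶜ ≤ r → u x = 0) ∧
      (∀ x, s ≤ Metric.infDist x Kᶜ → u x = 1) ∧ (∀ x, ‖u x‖ ≤ 1) ∧ ∀ x, ‖u x - 1‖ ≤ 1 := by
  have hc := Metric.continuous_infDist_pt (Kᶜ : Set (Euc d))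
  obtain ⟨f, h0, h1, h2⟩ := exists_contMDiffMap_zero_one_of_isClosed (n := (⊤ : ℕ∞))
    (modelWithCornersSelf ℝ (Euc d)) (isClosed_le hc continuous_const)
    (isClosed_le (continuous_const (y := s)) hc)
    (s := {x : Euc d | Metric.infDist x Kᶜ ≤ r}) (t := {x : Euc d | s ≤ Metric.infDist x Kᶜ})
    (Set.disjoint_left.2 fun x hx hx' => by
      rw [Set.mem_ofPred_eq] at hx hx'
      linarith)
  refine ⟨fun x => (f x : ℂ), Complex.ofRealCLM.contDiff.comp f.contMDiff.contDiff,
    fun x hx => ?_, fun x hx => ?_, fun x => ?_, fun x => ?_⟩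
  · simp [h0 (show x ∈ {x : Euc d | Metric.infDist x Kᶜ ≤ r} from hx)]
  · simp [h1 (show x ∈ {x : Euc d | s ≤ Metric.infDist x Kᶜ} from hx)]
  · rw [Complex.norm_real, Real.norm_eq_abs, abs_le]
    constructor <;> linarith [(h2 x).1, (h2 x).2]
  · rw [← Complex.ofReal_one, ← Complex.ofReal_sub, Complex.norm_real, Real.norm_eq_abs, abs_le]
    constructor <;> linarith [(h2 x).1, (h2 x).2]

variable {Mp : ℕ → ℝ}

/-- Smooth cutoffs of a compact set at scale `r` with controlled derivatives. -/
theorem exists_cutoff {K : Set (Euc d)} (hK : IsCompact K)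
    {a : ℕ → ℝ} (ha : ∀ j, 0 < a j) (hs : Summable a) (hanti : Antitone a) {r : ℝ} (hr : 0 < r)
    (har : d * ∑' j, a j ≤ r) :
    ∃ χ : Euc d → ℂ, ContDiff ℝ (⊤ : ℕ∞) χ ∧ (∀ x, Metric.infDist x Kᶜ ≤ r → χ x = 0) ∧
      (∀ x, 4 * r ≤ Metric.infDist x Kᶜ → χ x = 1) ∧ (∀ x, ‖χ x - 1‖ ≤ 1) ∧
      ∀ n x, ‖iteratedFDeriv ℝ n χ x‖ ≤ d ^ n * ∏ j ∈ Finset.range n, (a j)⁻¹ := by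
  obtain ⟨u, hu, hu0, hu1, hun, hun1⟩ :=
    exists_smooth_step (K := K) (r := 2 * r) (s := 3 * r) (by linarith)
  have hus : tsupport u ⊆ K :=
    tsupport_subset_of_infDist hr fun x hx => hu0 x (by linarith)
  have huc : HasCompactSupport u := hK.of_isClosed_subset (isClosed_tsupport u) hus
  obtain ⟨Φ, hΦ⟩ := exists_smoothing_operator d ha hs
  obtain ⟨h1, h2, h3, -⟩ := hΦ u hu huc
  have hdist : ∀ x y : Euc d, dist y x ≤ d * ∑' j, a j →
      Metric.infDist y Kᶜ ≤ Metric.infDist x Kᶜ + r ∧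
      Metric.infDist x Kᶜ ≤ Metric.infDist y Kᶜ + r := fun x y hy => by
    have e1 := Metric.infDist_le_infDist_add_dist (s := Kᶜ) (x := y) (y := x)
    have e2 := Metric.infDist_le_infDist_add_dist (s := Kᶜ) (x := x) (y := y)
    rw [dist_comm] at e2
    constructor <;> linarith
  refine ⟨Φ u, h1, fun x hx => ?_, fun x hx => ?_, fun x => h2 x 1 1 fun y _ => hun1 y,
    fun n x => ?_⟩
  · have := h2 x 0 0 fun y hy => by
      rw [hu0 y (by linarith [(hdist x y hy).1])]; simp
    simpa using this
  · have := h2 x 1 0 fun y hy => by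
      rw [hu1 y (by linarith [(hdist x y hy).2])]; simp
    exact sub_eq_zero.1 (norm_le_zero_iff.1 this)
  · refine norm_iteratedFDeriv_le_of_mderiv n h1 x
      (Finset.prod_nonneg fun j _ => (inv_pos.2 (ha j)).le) fun α hα => ?_
    refine (h3 α 1 hun x).trans ?_
    rw [mul_one, ← hα]
    exact prod_prod_range_le _ _ (fun j => (inv_pos.2 (ha j)).le) fun i j hij =>
      inv_anti₀ (ha j) (hanti hij)

/-- Functions supported in `K` can be smoothed into the Beurling class, uniformly closely and
without increasing the size of the derivatives, once they vanish near the complement of `K`. -/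
theorem exists_test_of_vanishing (hMpos : ∀ p, 0 < Mp p) (hM0 : Mp 0 = 1) (hM1 : CondM1 Mp)
    (hs : Summable fun p => (quot Mp p)⁻¹) {K : Set (Euc d)} (hK : IsCompact K)
    {v : Euc d → ℂ} (hv : ContDiff ℝ (⊤ : ℕ∞) v) {r : ℝ} (hr : 0 < r)
    (hv0 : ∀ x, Metric.infDist x Kᶜ ≤ r → v x = 0) {b : ℕ → ℝ} (hb0 : ∀ n, 0 ≤ b n)
    (hb : ∀ n x, ‖iteratedFDeriv ℝ n v x‖ ≤ b n) {η : ℝ} (hη : 0 < η) :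
    ∃ κ, IsTestFunction Mp K κ ∧ (∀ n x, ‖iteratedFDeriv ℝ n κ x‖ ≤ d ^ n * b n) ∧
      ∀ x, ‖κ x - v x‖ ≤ η := by
  have hvs : tsupport v ⊆ K := tsupport_subset_of_infDist hr fun x hx => hv0 x hx.le
  have hvc : HasCompactSupport v := hK.of_isClosed_subset (isClosed_tsupport v) hvs
  obtain ⟨δ, hδ, hvδ⟩ := Metric.uniformContinuous_iff.1
    (hvc.uniformContinuous_of_continuous hv.continuous) η hη
  have hq := quot_pos hMpos
  obtain ⟨a, ha, has, hlim⟩ :=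
    exists_summable_ratio_tendsto_zero (fun j => inv_pos.2 (hq j)) hs
  obtain ⟨τ, hτ, hτ1, hτ2⟩ : ∃ τ : ℝ, 0 < τ ∧ d * ∑' j, τ * a j ≤ r / 2 ∧
      d * ∑' j, τ * a j < δ := by
    have hS : 0 ≤ d * ∑' j, a j := mul_nonneg (Nat.cast_nonneg d) (tsum_nonneg fun j => (ha j).le)
    have hm : 0 < min (r / 2) (δ / 2) := lt_min (by linarith) (by linarith)
    refine ⟨min (r / 2) (δ / 2) / (d * ∑' j, a j + 1), by positivity, ?_⟩
    have key : d * ∑' j, min (r / 2) (δ / 2) / (d * ∑' j, a j + 1) * a j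
        ≤ min (r / 2) (δ / 2) := by
      rw [tsum_mul_left, mul_left_comm, div_mul_eq_mul_div, div_le_iff₀ (by linarith)]
      nlinarith
    exact ⟨key.trans (min_le_left _ _), by linarith [min_le_right (r / 2) (δ / 2)]⟩
  have ha' : ∀ j, 0 < τ * a j := fun j => mul_pos hτ (ha j)
  obtain ⟨Φ, hΦ⟩ := exists_smoothing_operator d ha' (has.mul_left τ)
  obtain ⟨h1, h2, h3, h4⟩ := hΦ v hv hvc
  refine ⟨Φ v, ⟨h1, ?_, fun t ht => ?_⟩, fun n x => ?_, fun x => ?_⟩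
  · refine tsupport_subset_of_infDist (half_pos hr) fun x hx => ?_
    have := h2 x 0 0 fun y hy => by
      rw [hv0 y ?_]; · simp
      have e1 := Metric.infDist_le_infDist_add_dist (s := Kᶜ) (x := y) (y := x)
      linarith
    simpa using this
  · have hlim' : Filter.Tendsto (fun j => (τ * a j)⁻¹ * (quot Mp j)⁻¹) Filter.atTop (nhds 0) := by
      have := hlim.const_mul τ⁻¹
      rw [mul_zero] at this
      refine this.congr fun j => ?_
      rw [mul_inv]; ring
    have ht' : 0 < t / (d + 1) := by positivity
    obtain ⟨B, hB0, hB⟩ := exists_prod_range_le_pow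
      (fun j => mul_nonneg (inv_pos.2 (ha' j)).le (inv_pos.2 (hq j)).le) hlim' ht'
    have hP : ∀ n, ∏ j ∈ Finset.range n, (τ * a j)⁻¹ ≤ B * (t / (d + 1)) ^ n * Mp n := fun n => by
      have := hB n
      rw [Finset.prod_mul_distrib, Finset.prod_inv_distrib (f := fun j => quot Mp j),
        ← eq_prod_quot hMpos hM0, ← div_eq_mul_inv, div_le_iff₀ (hMpos n)] at this
      exact this
    refine ⟨B ^ d * b 0, fun n x => ?_⟩
    have hbd := norm_iteratedFDeriv_le_of_mderiv n h1 x
      (B := B ^ d * (t / (d + 1)) ^ n * Mp n * b 0)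
      (by have := hMpos n; have := hb0 0; positivity) fun α hα => by
        refine (h3 α (b 0) (fun y => by simpa using hb 0 y) x).trans
          (mul_le_mul_of_nonneg_right ?_ (hb0 0))
        calc ∏ i, ∏ j ∈ Finset.range (α i), (τ * a j)⁻¹
            ≤ ∏ i, B * (t / (d + 1)) ^ α i * Mp (α i) :=
              Finset.prod_le_prod (fun i _ => Finset.prod_nonneg fun j _ =>
                (inv_pos.2 (ha' j)).le) fun i _ => hP _
          _ = B ^ d * (t / (d + 1)) ^ n * ∏ i, Mp (α i) := by
              rw [Finset.prod_mul_distrib, Finset.prod_mul_distrib, Finset.prod_pow_eq_pow_sum, hα]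
              simp
          _ ≤ _ := by
              refine mul_le_mul_of_nonneg_left ?_ (by positivity)
              rw [eq_prod_quot hMpos hM0 n, ← hα]
              simp only [eq_prod_quot hMpos hM0]
              exact prod_prod_range_le _ _ (fun j => (hq j).le) (monotone_quot hMpos hM1)
    refine hbd.trans ?_
    have e : (d : ℝ) ^ n * (t / (d + 1)) ^ n ≤ t ^ n := by
      rw [← mul_pow]
      refine pow_le_pow_left₀ (by positivity) ?_ n
      rw [← mul_div_assoc, div_le_iff₀ (by positivity)]
      nlinarith
    have e2 := mul_le_mul_of_nonneg_right e
      (show 0 ≤ B ^ d * Mp n * b 0 by have := hMpos n; have := hb0 0; positivity)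
    nlinarith [e2]
  · exact norm_iteratedFDeriv_le_of_mderiv n h1 x (hb0 n) fun α hα =>
      h4 α (b n) (fun y => (norm_mderiv_le α hv y).trans (by rw [hα]; exact hb n y)) x
  · refine h2 x (v x) η fun y hy => ?_
    rw [← dist_eq_norm]
    exact (hvδ (hy.trans_lt hτ2)).le

end Approximation

section TestApproximation

variable {d : ℕ} {Mp : ℕ → ℝ}

/-- At points within `5 r` of the complement of `K`, a function supported in `K` whose derivatives
are small compared with `(M_p)` is flat, and so is its product with a cutoff. -/
theorem norm_iteratedFDeriv_cutoff_mul_le (hMpos : ∀ p, 0 < Mp p) (hM0 : Mp 0 = 1)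
    (hM1 : CondM1 Mp) {c0 H : ℝ} (hc0 : 1 ≤ c0) (hH : 1 ≤ H) (hM2 : CondM2 Mp c0 H)
    {K : Set (Euc d)} (hne : Kᶜ.Nonempty) {g χ : Euc d → ℂ} (hg : ContDiff ℝ (⊤ : ℕ∞) g)
    (hgs : tsupport g ⊆ K) {h : ℝ} (hh : 0 < h)
    (hgb : ∀ n x, ‖iteratedFDeriv ℝ n g x‖ ≤ h ^ n * Mp n) (hχ : ContDiff ℝ (⊤ : ℕ∞) χ)
    {L Q ρ : ℝ} (hL : 0 ≤ L) (hQ : 0 ≤ Q)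
    (hχb : ∀ n x, ‖iteratedFDeriv ℝ n χ x‖ ≤ L ^ n * Mp n * Q) {p : ℕ}
    (hρ : Q * ((h * H) ^ p * Mp p * ρ ^ p / p.factorial) ≤ 1) {x : Euc d}
    (hx : Metric.infDist x Kᶜ < ρ) (n : ℕ) :
    ‖iteratedFDeriv ℝ n (fun y => χ y * g y) x‖ ≤ c0 * (L + h * H) ^ n * Mp n := by
  obtain ⟨y, hy, hxy⟩ := (Metric.infDist_lt_iff hne).1 hx
  have hflat : ∀ i, ‖iteratedFDeriv ℝ i g x‖ ≤
      c0 * (h * H) ^ i * Mp i * ((h * H) ^ p * Mp p * ρ ^ p / p.factorial) := fun i => by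
    refine (norm_iteratedFDeriv_le_of_flat hg p i (hgb _)
      (fun k => iteratedFDeriv_eq_zero_of_notMem hgs hy k) x).trans ?_
    have e1 : dist x y ^ p ≤ ρ ^ p := pow_le_pow_left₀ dist_nonneg hxy.le p
    have e2 := mul_le_mul_of_nonneg_left (hM2 i p) (pow_nonneg hh.le (i + p))
    rw [mul_div_assoc]
    calc h ^ (i + p) * Mp (i + p) * (dist x y ^ p / p.factorial)
        ≤ h ^ (i + p) * (c0 * H ^ (i + p) * Mp i * Mp p) * (ρ ^ p / p.factorial) := by
          have h1 := hMpos i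
          have h2 := hMpos p
          have h3 : 0 < c0 := by linarith
          have h4 : 0 < H := by linarith
          exact mul_le_mul e2 (by gcongr) (by positivity) (by positivity)
      _ = _ := by rw [pow_add, pow_add, mul_pow, mul_pow]; ring
  have hcast : ((n : ℕ) : WithTop ℕ∞) ≤ ((⊤ : ℕ∞) : WithTop ℕ∞) := by exact_mod_cast le_top
  refine (norm_iteratedFDeriv_mul_le hχ hg x hcast).trans ?_
  rw [add_pow, Finset.mul_sum, Finset.sum_mul]
  refine Finset.sum_le_sum fun i hi => ?_
  have hin : i ≤ n := by have := Finset.mem_range.1 hi; omega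
  have hpos : 0 < h * H := by positivity
  have hMi := hMpos i
  have hMni := hMpos (n - i)
  calc (n.choose i : ℝ) * ‖iteratedFDeriv ℝ i χ x‖ * ‖iteratedFDeriv ℝ (n - i) g x‖
      ≤ n.choose i * (L ^ i * Mp i * Q) * (c0 * (h * H) ^ (n - i) * Mp (n - i) *
          ((h * H) ^ p * Mp p * ρ ^ p / p.factorial)) := by
        gcongr
        · exact hχb i x
        · exact hflat _
    _ = n.choose i * L ^ i * c0 * (h * H) ^ (n - i) * (Mp i * Mp (n - i)) *
          (Q * ((h * H) ^ p * Mp p * ρ ^ p / p.factorial)) := by ring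
    _ ≤ n.choose i * L ^ i * c0 * (h * H) ^ (n - i) * Mp n * 1 := by
        have h1 := mul_le_add hMpos hM0 hM1 i (n - i)
        rw [Nat.add_sub_cancel' hin] at h1
        have hMn := hMpos n
        refine mul_le_mul (by gcongr) hρ ?_ (by positivity)
        have := hMpos p
        have hρ0 : 0 < ρ := Metric.infDist_nonneg.trans_lt hx
        positivity
    _ = _ := by ring

theorem exists_test_approx (hd : 0 < d) (hMpos : ∀ p, 0 < Mp p) (hM0 : Mp 0 = 1)
    (hM1 : CondM1 Mp) (hM2 : CondM2' Mp) (hM3 : CondM3 Mp)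
    (hs : Summable fun p => (quot Mp p)⁻¹) {K : Set (Euc d)} (hK : IsCompact K)
    {t : ℝ} (ht : 0 < t) :
    ∃ h : ℝ, 0 < h ∧ ∃ C : ℝ, 0 < C ∧ ∀ g : Euc d → ℂ, ContDiff ℝ (⊤ : ℕ∞) g → tsupport g ⊆ K →
      (∀ n x, ‖iteratedFDeriv ℝ n g x‖ ≤ h ^ n * Mp n) → ∀ η : ℝ, 0 < η →
      ∃ κ, IsTestFunction Mp K κ ∧ (∀ n x, ‖iteratedFDeriv ℝ n κ x‖ ≤ C * t ^ n * Mp n) ∧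
        ∀ x, ‖κ x - g x‖ ≤ η := by
  obtain ⟨c0, H, hc0, hH, hM2⟩ := hM2
  obtain ⟨c1, hc1, hM3⟩ := hM3
  have hq := quot_pos hMpos
  have hd' : (0 : ℝ) < d := by exact_mod_cast hd
  have hne := nonempty_compl_of_isCompact hd hK
  set lam : ℝ := t / d with hlam
  have hlam0 : 0 < lam := div_pos ht hd'
  set θ : ℝ := 2 * d / lam with hθ
  have hθ0 : 0 < θ := by positivity
  set E : ℝ := Real.exp 1 * (10 * d * c1 * θ) with hE
  have hE0 : 0 < E := by positivity
  set h : ℝ := min (lam / 2) E⁻¹ / H with hh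
  have hH0 : 0 < H := by linarith
  have hh0 : 0 < h := by positivity
  have hhH : h * H = min (lam / 2) E⁻¹ := div_mul_cancel₀ _ hH0.ne'
  have hhH1 : h * H ≤ lam / 2 := hhH ▸ min_le_left _ _
  have hhH2 : h * H * E ≤ 1 := by
    rw [← le_div_iff₀ hE0, one_div, hhH]; exact min_le_right _ _
  have hhlam : h ≤ lam := by nlinarith
  refine ⟨h, hh0, c0, by linarith, fun g hg hgs hgb η hη => ?_⟩
  have hgc : HasCompactSupport g := hK.of_isClosed_subset (isClosed_tsupport g) hgs
  obtain ⟨δ, hδ, hgδ⟩ := Metric.uniformContinuous_iff.1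
    (hgc.uniformContinuous_of_continuous hg.continuous) (η / 2) (half_pos hη)
  have hlim := tendsto_mul_of_antitone_summable (fun j => (inv_pos.2 (hq j)).le)
    (fun i j hij => inv_anti₀ (hq i) (monotone_quot hMpos hM1 hij)) hs
  obtain ⟨p, hp1, hp⟩ : ∃ p : ℕ, 1 ≤ p ∧
      5 * (d * (θ * (2 * c1 * (p * (quot Mp p)⁻¹)))) < δ := by
    have h1 := (hlim.const_mul (5 * (d * (θ * (2 * c1))))).eventually_lt_const
      (u := δ) (by simpa using hδ)
    obtain ⟨p, hp, hp1⟩ := (h1.and (Filter.eventually_ge_atTop 1)).exists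
    exact ⟨p, hp1, lt_of_eq_of_lt (by ring) hp⟩
  set r : ℝ := d * (θ * (2 * c1 * (p * (quot Mp p)⁻¹))) with hr
  have hp0 : (0 : ℝ) < p := by exact_mod_cast hp1
  have hr0 : 0 < r := by have := hq p; positivity
  obtain ⟨χ, hχ, hχ0, hχ1, hχ2, hχb⟩ := exists_cutoff hK
    (a := fun j => θ * (quot Mp (max j p))⁻¹) (fun j => mul_pos hθ0 (inv_pos.2 (hq _)))
    ((summable_quot_max hs p).mul_left θ)
    (fun i j hij => mul_le_mul_of_nonneg_left
      (inv_anti₀ (hq _) (monotone_quot hMpos hM1 (by omega))) hθ0.le) hr0 (by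
      rw [tsum_mul_left, hr]
      have := tsum_quot_max_le hc1 hM3 hMpos hs hp1
      gcongr)
  have hχb' : ∀ n x, ‖iteratedFDeriv ℝ n χ x‖ ≤
      (d / θ) ^ n * Mp n * (quot Mp p ^ p / Mp p) := fun n x => by
    refine (hχb n x).trans ?_
    simp only [mul_inv, inv_inv]
    rw [Finset.prod_mul_distrib, Finset.prod_const, Finset.card_range, ← mul_assoc, ← mul_pow,
      ← div_eq_mul_inv, mul_assoc]
    exact mul_le_mul_of_nonneg_left (prod_quot_max_le hMpos hM1 p n) (by positivity)
  have hdθ : d / θ = lam / 2 := by rw [hθ]; field_simp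
  have hρ : quot Mp p ^ p / Mp p * ((h * H) ^ p * Mp p * (5 * r) ^ p / p.factorial) ≤ 1 := by
    have e1 : quot Mp p * (5 * r) = (10 * d * c1 * θ) * p := by
      rw [hr]; have := (hq p).ne'; field_simp; ring
    have e2 : quot Mp p ^ p / Mp p * ((h * H) ^ p * Mp p * (5 * r) ^ p / p.factorial) =
        (h * H * (10 * d * c1 * θ)) ^ p * ((p : ℝ) ^ p / p.factorial) := by
      have e3 : (quot Mp p * (5 * r)) ^ p = ((10 * d * c1 * θ) * p) ^ p := by rw [e1]
      rw [mul_pow, mul_pow (10 * d * c1 * θ)] at e3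
      have := (hMpos p).ne'
      calc _ = (h * H) ^ p * (quot Mp p ^ p * (5 * r) ^ p) / p.factorial := by field_simp
        _ = _ := by rw [e3, mul_pow (h * H)]; ring
    rw [e2]
    have e4 : (p : ℝ) ^ p / p.factorial ≤ Real.exp 1 ^ p := by
      rw [← Real.exp_nat_mul, mul_one]
      exact Real.pow_div_factorial_le_exp _ hp0.le p
    calc _ ≤ (h * H * (10 * d * c1 * θ)) ^ p * Real.exp 1 ^ p := by gcongr
      _ = (h * H * E) ^ p := by rw [← mul_pow, hE]; ring
      _ ≤ 1 := pow_le_one₀ (by positivity) hhH2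
  set v : Euc d → ℂ := fun y => χ y * g y with hv
  have hvb : ∀ n x, ‖iteratedFDeriv ℝ n v x‖ ≤ c0 * lam ^ n * Mp n := fun n x => by
    have hMn := hMpos n
    rcases lt_or_ge (Metric.infDist x Kᶜ) (5 * r) with hx | hx
    · refine (norm_iteratedFDeriv_cutoff_mul_le hMpos hM0 hM1 hc0 hH hM2 hne hg hgs hh0 hgb hχ
        (by positivity) (div_nonneg (pow_nonneg (hq p).le p) (hMpos p).le) hχb' hρ hx n).trans ?_
      have : d / θ + h * H ≤ lam := by linarith
      gcongr
    · have hev : v =ᶠ[nhds x] g := by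
        have hopen : IsOpen {y : Euc d | 4 * r < Metric.infDist y Kᶜ} :=
          isOpen_lt continuous_const (Metric.continuous_infDist_pt _)
        filter_upwards [hopen.mem_nhds (show 4 * r < Metric.infDist x Kᶜ by linarith)] with y hy
        rw [hv]
        simp [hχ1 y (le_of_lt hy)]
      rw [(hev.iteratedFDeriv ℝ n).eq_of_nhds]
      refine (hgb n x).trans ?_
      calc h ^ n * Mp n ≤ lam ^ n * Mp n := by gcongr
        _ ≤ c0 * (lam ^ n * Mp n) := le_mul_of_one_le_left (by positivity) hc0
        _ = _ := by ring
  have hvg : ∀ x, ‖v x - g x‖ ≤ η / 2 := fun x => by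
    rcases lt_or_ge (Metric.infDist x Kᶜ) (5 * r) with hx | hx
    · obtain ⟨y, hy, hxy⟩ := (Metric.infDist_lt_iff hne).1 hx
      have hgy : g y = 0 := image_eq_zero_of_notMem_tsupport fun hy' => hy (hgs hy')
      have h1 := hgδ (hxy.trans hp)
      rw [hgy, dist_zero_right] at h1
      have e : v x - g x = (χ x - 1) * g x := by rw [hv]; ring
      rw [e, norm_mul]
      nlinarith [hχ2 x, norm_nonneg (g x)]
    · have : v x = g x := by rw [hv]; simp [hχ1 x (by linarith)]
      rw [this, sub_self, norm_zero]
      linarith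
  obtain ⟨κ, h1, h2, h3⟩ := exists_test_of_vanishing hMpos hM0 hM1 hs hK (hχ.mul hg) hr0
    (fun x hx => by rw [hχ0 x hx, zero_mul]) (b := fun n => c0 * lam ^ n * Mp n)
    (fun n => by have := hMpos n; positivity) hvb (half_pos hη)
  refine ⟨κ, h1, fun n x => (h2 n x).trans (le_of_eq ?_), fun x => ?_⟩
  · have : (d : ℝ) * lam = t := by rw [hlam]; field_simp
    rw [← this, mul_pow]; ring
  · calc ‖κ x - g x‖ = ‖(κ x - v x) + (v x - g x)‖ := by congr 1; ring
      _ ≤ η := (norm_add_le _ _).trans (by linarith [h3 x, hvg x])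

end TestApproximation

section UniformBoundedness

open MeasureTheory

variable {d : ℕ} {Mp : ℕ → ℝ} {K : Set (Euc d)}

theorem summable_norm_l1 (a : lp (fun _ : ℕ => ℂ) 1) : Summable fun i => ‖a i‖ := by
  simpa using (lp.memℓp a).summable (by simp)

theorem norm_l1_eq_tsum (a : lp (fun _ : ℕ => ℂ) 1) : ‖a‖ = ∑' i, ‖a i‖ := by
  simpa using lp.norm_eq_tsum_rpow (p := 1) (by simp) a

/-- The `ℓ¹` superposition of a sequence of functions. -/
noncomputable def superpose (κ : ℕ → Euc d → ℂ) (a : lp (fun _ : ℕ => ℂ) 1) : Euc d → ℂ :=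
  fun x => ∑' i, a i * κ i x

theorem norm_iteratedFDeriv_coeff_mul_le {κ : ℕ → Euc d → ℂ} (hκ : ∀ i, ContDiff ℝ (⊤ : ℕ∞) (κ i))
    (a : lp (fun _ : ℕ => ℂ) 1) (n i : ℕ) {x : Euc d} {B : ℝ}
    (hB : ‖iteratedFDeriv ℝ n (κ i) x‖ ≤ B) :
    ‖iteratedFDeriv ℝ n (fun y => a i * κ i y) x‖ ≤ ‖a i‖ * B := by
  have hcast : ((n : ℕ) : WithTop ℕ∞) ≤ ((⊤ : ℕ∞) : WithTop ℕ∞) := by exact_mod_cast le_top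
  have := iteratedFDeriv_const_smul_apply (𝕜 := ℝ) (a := a i) (f := κ i) (x := x) (i := n)
    ((hκ i).contDiffAt.of_le hcast)
  change iteratedFDeriv ℝ n (fun y => a i * κ i y) x = _ at this
  rw [this, norm_smul]
  gcongr

theorem superpose_spec (hMpos : ∀ p, 0 < Mp p) (hK : IsCompact K) {κ : ℕ → Euc d → ℂ}
    (hκ : ∀ i, IsTestFunction Mp K (κ i))
    (hb : ∀ i n x, ‖iteratedFDeriv ℝ n (κ i) x‖ ≤ (1 / ((i : ℝ) + 1)) ^ n * Mp n)
    (a : lp (fun _ : ℕ => ℂ) 1) : IsTestFunction Mp K (superpose κ a) := by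
  have hsum := summable_norm_l1 a
  have h1 : ∀ (n i : ℕ) (x : Euc d),
      ‖iteratedFDeriv ℝ n (fun y => a i * κ i y) x‖ ≤ ‖a i‖ * Mp n := fun n i x => by
    refine norm_iteratedFDeriv_coeff_mul_le (fun i => (hκ i).1) a n i ((hb i n x).trans ?_)
    refine mul_le_of_le_one_left (hMpos n).le (pow_le_one₀ (by positivity) ?_)
    rw [div_le_one (by positivity)]
    linarith [Nat.cast_nonneg (α := ℝ) i]
  have hcd : ∀ i, ContDiff ℝ (⊤ : ℕ∞) fun y => a i * κ i y :=
    fun i => contDiff_const.mul (hκ i).1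
  have hsm : ∀ n : ℕ, ((n : ℕ∞) : ℕ∞) ≤ ⊤ → Summable fun i => ‖a i‖ * Mp n :=
    fun n _ => hsum.mul_right _
  refine ⟨contDiff_tsum hcd hsm fun n i x _ => h1 n i x, ?_, fun t ht => ?_⟩
  · refine closure_minimal (fun x hx => ?_) hK.isClosed
    by_contra hxK
    refine hx ?_
    have : ∀ i, κ i x = 0 := fun i =>
      image_eq_zero_of_notMem_tsupport fun h => hxK ((hκ i).2.1 h)
    simp [superpose, this]
  · choose B hB using fun i => (hκ i).2.2 t ht
    obtain ⟨i0, hi0⟩ := exists_nat_one_div_lt ht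
    set S : ℝ := 1 + ∑ i ∈ Finset.range i0, |B i| with hS
    have hS1 : 1 ≤ S := by
      have : 0 ≤ ∑ i ∈ Finset.range i0, |B i| := Finset.sum_nonneg fun i _ => abs_nonneg _
      linarith
    have h2 : ∀ n i x, ‖iteratedFDeriv ℝ n (κ i) x‖ ≤ S * t ^ n * Mp n := fun n i x => by
      have hp : 0 ≤ t ^ n * Mp n := mul_nonneg (pow_nonneg ht.le n) (hMpos n).le
      rw [mul_assoc]
      rcases lt_or_ge i i0 with h | h
      · have e1 : |B i| ≤ S := by
          have := Finset.single_le_sum (f := fun i => |B i|) (fun i _ => abs_nonneg _)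
            (Finset.mem_range.2 h)
          linarith
        have e2 := hB i n x
        rw [mul_assoc] at e2
        exact e2.trans (mul_le_mul_of_nonneg_right ((le_abs_self _).trans e1) hp)
      · refine (hb i n x).trans (le_trans ?_ (le_mul_of_one_le_left hp hS1))
        have e1 : 1 / ((i : ℝ) + 1) ≤ t := by
          refine le_trans (one_div_le_one_div_of_le (by positivity) ?_) hi0.le
          have : (i0 : ℝ) ≤ i := by exact_mod_cast h
          linarith
        have := (hMpos n).le
        gcongr
    refine ⟨‖a‖ * S, fun n x => ?_⟩
    have h3 : ∀ i, ‖iteratedFDeriv ℝ n (fun y => a i * κ i y) x‖ ≤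
        ‖a i‖ * (S * t ^ n * Mp n) := fun i =>
      norm_iteratedFDeriv_coeff_mul_le (fun i => (hκ i).1) a n i (h2 n i x)
    have h4 : iteratedFDeriv ℝ n (superpose κ a) x =
        ∑' i, iteratedFDeriv ℝ n (fun y => a i * κ i y) x :=
      iteratedFDeriv_tsum_apply hcd hsm (fun n i x _ => h1 n i x) le_top x
    rw [h4]
    refine (tsum_of_norm_bounded (hsum.mul_right (S * t ^ n * Mp n)).hasSum h3).trans
      (le_of_eq ?_)
    rw [tsum_mul_right, ← norm_l1_eq_tsum]
    ring

/-- A family of functionals that is pointwise controlled on the Beurling class as `ε → 0` is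
uniformly controlled on a neighbourhood of zero, for all small `ε`. -/
theorem exists_uniform_bound (hMpos : ∀ p, 0 < Mp p) (hM0 : Mp 0 = 1) (hK : IsCompact K)
    {f : ℝ → Euc d → ℂ} (hf : ∀ ε ∈ Set.Ioo (0 : ℝ) 1, Continuous (f ε))
    (hfc : ∀ ε ∈ Set.Ioo (0 : ℝ) 1, HasCompactSupport (f ε)) {w : ℝ → ℝ} (hw : ∀ ε, 0 ≤ w ε)
    (hweak : ∀ κ, IsTestFunction Mp K κ → ∃ ε₀ : ℝ, 0 < ε₀ ∧ ∃ C : ℝ, ∀ ε : ℝ, 0 < ε → ε < ε₀ →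
      ‖∫ x, f ε x * κ x‖ * w ε ≤ C) :
    ∃ N : ℕ, ∀ ε : ℝ, 0 < ε → ε < 1 / ((N : ℝ) + 1) → ∀ κ, IsTestFunction Mp K κ →
      (∀ n x, ‖iteratedFDeriv ℝ n κ x‖ ≤ (1 / ((N : ℝ) + 1)) ^ n * Mp n) →
      ‖∫ x, f ε x * κ x‖ * w ε ≤ N + 1 := by
  by_contra! hcon
  choose e he0 he1 κ hκ hb hlt using hcon
  have heI : ∀ N, e N ∈ Set.Ioo (0 : ℝ) 1 := fun N => ⟨he0 N, (he1 N).trans_le (by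
    rw [div_le_one (by positivity)]; linarith [Nat.cast_nonneg (α := ℝ) N])⟩
  have htest := superpose_spec hMpos hK hκ hb
  have hbd : ∀ i x, ‖κ i x‖ ≤ 1 := fun i x => by simpa [hM0] using hb i 0 x
  have hsx : ∀ (a : lp (fun _ : ℕ => ℂ) 1) x, Summable fun i => a i * κ i x := fun a x =>
    Summable.of_norm_bounded (summable_norm_l1 a) fun i => by
      rw [norm_mul]; exact mul_le_of_le_one_right (norm_nonneg _) (hbd i x)
  have hsn : ∀ (a : lp (fun _ : ℕ => ℂ) 1) x, ‖superpose κ a x‖ ≤ ‖a‖ := fun a x => by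
    rw [norm_l1_eq_tsum]
    refine tsum_of_norm_bounded (summable_norm_l1 a).hasSum fun i => ?_
    rw [norm_mul]
    exact mul_le_of_le_one_right (norm_nonneg _) (hbd i x)
  have h_int : ∀ N a, Integrable fun x => f (e N) x * superpose κ a x := fun N a =>
    ((hf _ (heI N)).mul (htest a).1.continuous).integrable_of_hasCompactSupport
      (hfc _ (heI N)).mul_right
  let Φ : ℕ → lp (fun _ : ℕ => ℂ) 1 →L[ℂ] ℂ := fun N =>
    LinearMap.mkContinuous
      { toFun := fun a => (w (e N) : ℂ) * ∫ x, f (e N) x * superpose κ a x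
        map_add' := fun a b => by
          rw [← mul_add, ← integral_add (h_int N a) (h_int N b)]
          congr 1
          refine integral_congr_ae (Filter.Eventually.of_forall fun x => ?_)
          have : superpose κ (a + b) x = superpose κ a x + superpose κ b x := by
            unfold superpose
            rw [← (hsx a x).tsum_add (hsx b x)]
            exact tsum_congr fun i => by simp [add_mul]
          simp only [this, mul_add]
        map_smul' := fun c a => by
          have : ∀ x, superpose κ (c • a) x = c * superpose κ a x := fun x => by
            unfold superpose
            rw [← tsum_mul_left]
            exact tsum_congr fun i => by simp [mul_assoc]
          simp only [this, RingHom.id_apply, smul_eq_mul, mul_left_comm _ c, integral_const_mul] }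
      (w (e N) * ∫ x, ‖f (e N) x‖) fun a => by
        have hfi : Integrable (f (e N)) :=
          (hf _ (heI N)).integrable_of_hasCompactSupport (hfc _ (heI N))
        change ‖(w (e N) : ℂ) * ∫ x, f (e N) x * superpose κ a x‖ ≤ _
        rw [norm_mul, Complex.norm_real, Real.norm_eq_abs, abs_of_nonneg (hw _), mul_assoc]
        refine mul_le_mul_of_nonneg_left ?_ (hw _)
        rw [← integral_mul_const]
        refine norm_integral_le_of_norm_le (hfi.norm.mul_const _)
          (Filter.Eventually.of_forall fun x => ?_)
        rw [norm_mul]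
        exact mul_le_mul_of_nonneg_left (hsn a x) (norm_nonneg _)
  have hΦ : ∀ N a, ‖Φ N a‖ = ‖∫ x, f (e N) x * superpose κ a x‖ * w (e N) := fun N a => by
    change ‖(w (e N) : ℂ) * ∫ x, f (e N) x * superpose κ a x‖ = _
    rw [norm_mul, Complex.norm_real, Real.norm_eq_abs, abs_of_nonneg (hw _), mul_comm]
  obtain ⟨C, hC⟩ := banach_steinhaus (g := Φ) fun a => by
    obtain ⟨ε₀, hε₀, C, hC⟩ := hweak _ (htest a)
    obtain ⟨N0, hN0⟩ := exists_nat_one_div_lt hε₀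
    refine ⟨|C| + ∑ N ∈ Finset.range N0, ‖Φ N a‖, fun N => ?_⟩
    have hnn : 0 ≤ ∑ N ∈ Finset.range N0, ‖Φ N a‖ := Finset.sum_nonneg fun _ _ => norm_nonneg _
    rcases lt_or_ge N N0 with h | h
    · have := Finset.single_le_sum (f := fun N => ‖Φ N a‖) (fun _ _ => norm_nonneg _)
        (Finset.mem_range.2 h)
      linarith [abs_nonneg C]
    · rw [hΦ]
      have h1 : e N < ε₀ := by
        refine (he1 N).trans_le (le_trans (one_div_le_one_div_of_le (by positivity) ?_) hN0.le)
        have : (N0 : ℝ) ≤ N := by exact_mod_cast h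
        linarith
      linarith [hC _ (he0 N) h1, le_abs_self C]
  obtain ⟨N, hN⟩ := exists_nat_gt C
  have h1 := (Φ N).le_opNorm (lp.single 1 N 1)
  rw [lp.norm_single (by simp), norm_one, mul_one, hΦ] at h1
  have h2 : superpose κ (lp.single 1 N 1) = κ N := by
    ext x
    unfold superpose
    rw [tsum_eq_single N fun i hi => by rw [lp.single_apply_ne _ _ _ hi, zero_mul],
      lp.single_apply_self, one_mul]
  rw [h2] at h1
  linarith [hlt N, hC N]

end UniformBoundedness

section Interpolation

open MeasureTheory

variable {d : ℕ}

theorem integral_lderiv_mul (l : List (Fin d)) {u v : Euc d → ℂ} (hu : ContDiff ℝ (⊤ : ℕ∞) u)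
    (huc : HasCompactSupport u) (hv : ContDiff ℝ (⊤ : ℕ∞) v) :
    ∫ x, lderiv l u x * v x = (-1) ^ l.length * ∫ x, u x * lderiv l.reverse v x := by
  induction l generalizing v with
  | nil => simp [lderiv]
  | cons j l ih =>
    have h1 := contDiff_lderiv l hu
    have h2 := hasCompactSupport_lderiv l huc
    have e : ∫ x, lderiv l u x * pderiv1 j v x = -∫ x, pderiv1 j (lderiv l u) x * v x := by
      refine integral_mul_fderiv_eq_neg_fderiv_mul_of_integrable ?_ ?_ ?_
        (fun x _ => (h1.differentiable (by simp)) x) (fun x _ => (hv.differentiable (by simp)) x)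
      · exact ((contDiff_pderiv1 j h1).continuous.mul hv.continuous).integrable_of_hasCompactSupport
          (hasCompactSupport_pderiv1 j h2).mul_right
      · exact (h1.continuous.mul (contDiff_pderiv1 j hv).continuous).integrable_of_hasCompactSupport
          h2.mul_right
      · exact (h1.continuous.mul hv.continuous).integrable_of_hasCompactSupport h2.mul_right
    have e2 := ih (contDiff_pderiv1 j hv)
    rw [e] at e2
    change ∫ x, pderiv1 j (lderiv l u) x * v x = _
    rw [List.reverse_cons, lderiv_append, List.length_cons, pow_succ]
    change _ = (-1) ^ l.length * -1 * ∫ x, u x * lderiv l.reverse (pderiv1 j v) x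
    linear_combination -e2

theorem lderiv_conj (l : List (Fin d)) (f : Euc d → ℂ) :
    lderiv l (fun x => (starRingEnd ℂ) (f x)) = fun x => (starRingEnd ℂ) (lderiv l f x) := by
  induction l with
  | nil => rfl
  | cons j l ih =>
    change pderiv1 j (lderiv l _) = _
    rw [ih]
    ext x
    have := Complex.conjCLE.comp_fderiv (f := lderiv l f) (x := x)
    change fderiv ℝ (Complex.conjCLE ∘ lderiv l f) x _ = _
    rw [this]
    rfl

theorem contDiff_conj {f : Euc d → ℂ} (hf : ContDiff ℝ (⊤ : ℕ∞) f) :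
    ContDiff ℝ (⊤ : ℕ∞) fun x => (starRingEnd ℂ) (f x) :=
  Complex.conjCLE.contDiff.comp hf

/-- Interpolation in `L²`: a derivative is controlled by the function and by a derivative of twice
the order. -/
theorem integral_norm_lderiv_sq_le (l : List (Fin d)) {g : Euc d → ℂ}
    (hg : ContDiff ℝ (⊤ : ℕ∞) g) (hgc : HasCompactSupport g) {B : ℝ}
    (hB : ∀ x, ‖iteratedFDeriv ℝ (2 * l.length) g x‖ ≤ B) :
    ∫ x, ‖lderiv l g x‖ ^ 2 ≤ B * ∫ x, ‖g x‖ := by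
  have h1 := integral_lderiv_mul l hg hgc (contDiff_conj (contDiff_lderiv l hg))
  have h2 : ∀ x, lderiv l g x * (starRingEnd ℂ) (lderiv l g x) = ((‖lderiv l g x‖ ^ 2 : ℝ) : ℂ) :=
    fun x => by rw [Complex.mul_conj, Complex.normSq_eq_norm_sq]
  simp only [h2] at h1
  rw [integral_complex_ofReal, lderiv_conj, ← lderiv_append] at h1
  have h3 := congrArg (fun z : ℂ => ‖z‖) h1
  simp only [norm_mul, norm_pow, norm_neg, norm_one, one_pow, one_mul, Complex.norm_real,
    Real.norm_eq_abs] at h3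
  rw [abs_of_nonneg (integral_nonneg fun x => by positivity)] at h3
  rw [h3, ← integral_const_mul]
  refine norm_integral_le_of_norm_le
    ((hg.continuous.integrable_of_hasCompactSupport hgc).norm.const_mul B)
    (Filter.Eventually.of_forall fun x => ?_)
  rw [norm_mul, RCLike.norm_conj, mul_comm]
  refine mul_le_mul_of_nonneg_right ((norm_lderiv_le _ hg x).trans ?_) (norm_nonneg _)
  have : (l.reverse ++ l).length = 2 * l.length := by simp; omega
  rw [this]
  exact hB x

theorem norm_lderiv_sub_le (l : List (Fin d)) {g : Euc d → ℂ} (hg : ContDiff ℝ (⊤ : ℕ∞) g)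
    {L : ℝ} (hL : ∀ x, ‖iteratedFDeriv ℝ (l.length + 1) g x‖ ≤ L) (x y : Euc d) :
    ‖lderiv l g x - lderiv l g y‖ ≤ L * dist x y := by
  have hdiff : Differentiable ℝ (iteratedFDeriv ℝ l.length g) :=
    hg.differentiable_iteratedFDeriv (by exact_mod_cast WithTop.coe_lt_top _)
  have h1 := Convex.norm_image_sub_le_of_norm_fderiv_le (𝕜 := ℝ) (s := Set.univ)
    (f := iteratedFDeriv ℝ l.length g) (C := L) (fun z _ => hdiff z)
    (fun z _ => by rw [norm_fderiv_iteratedFDeriv]; exact hL z) convex_univ (Set.mem_univ y)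
    (Set.mem_univ x)
  rw [dist_eq_norm]
  refine le_trans ?_ h1
  rw [lderiv_eq_iteratedFDeriv l hg x, lderiv_eq_iteratedFDeriv l hg y]
  change ‖iteratedFDeriv ℝ l.length g x _ - iteratedFDeriv ℝ l.length g y _‖ ≤ _
  rw [← sub_apply]
  refine (ContinuousMultilinearMap.le_opNorm _ _).trans ?_
  simp

/-- A Lipschitz function is controlled in the supremum norm by its `L²` norm. -/
theorem norm_pow_mul_volume_ball_le {G : Euc d → ℂ} {L : ℝ} (hL : 0 < L)
    (hLip : ∀ x y, ‖G x - G y‖ ≤ L * dist x y) (h_int : Integrable fun x => ‖G x‖ ^ 2)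
    (x : Euc d) :
    ‖G x‖ ^ (d + 2) * volume.real (Metric.ball (0 : Euc d) 1) ≤
      4 * (2 * L) ^ d * ∫ y, ‖G y‖ ^ 2 := by
  have hI : 0 ≤ ∫ y, ‖G y‖ ^ 2 := integral_nonneg fun y => by positivity
  rcases (norm_nonneg (G x)).eq_or_lt with h0 | h0
  · rw [← h0, zero_pow (by omega), zero_mul]
    positivity
  set m := ‖G x‖ with hm
  have hR : 0 < m / (2 * L) := by positivity
  have hvol : volume.real (Metric.ball x (m / (2 * L))) =
      (m / (2 * L)) ^ d * volume.real (Metric.ball (0 : Euc d) 1) := by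
    have := Measure.addHaar_ball_mul_of_pos (volume : Measure (Euc d)) x hR 1
    rw [mul_one] at this
    rw [Measure.real, this, ENNReal.toReal_mul, ENNReal.toReal_ofReal (by positivity),
      finrank_euclideanSpace_fin]
    rfl
  have h1 : ∫ y in Metric.ball x (m / (2 * L)), (m ^ 2 / 4 : ℝ) ≤
      ∫ y in Metric.ball x (m / (2 * L)), ‖G y‖ ^ 2 := by
    refine setIntegral_mono_on (integrableOn_const (measure_ball_lt_top.ne)) h_int.integrableOn
      measurableSet_ball fun y hy => ?_
    have h2 := hLip x y
    rw [Metric.mem_ball, dist_comm, lt_div_iff₀ (by positivity)] at hy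
    have h3 := norm_sub_norm_le (G x) (G y)
    have h4 : m / 2 ≤ ‖G y‖ := by linarith
    nlinarith
  have h2 := setIntegral_le_integral (s := Metric.ball x (m / (2 * L))) h_int
    (Filter.Eventually.of_forall fun y => by positivity)
  rw [setIntegral_const, hvol, smul_eq_mul] at h1
  have h3 := h1.trans h2
  have h4 : m ^ (d + 2) * volume.real (Metric.ball (0 : Euc d) 1) = 4 * (2 * L) ^ d *
      ((m / (2 * L)) ^ d * volume.real (Metric.ball (0 : Euc d) 1) * (m ^ 2 / 4)) := by
    rw [div_pow]
    field_simp
    ring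
  rw [h4]
  exact mul_le_mul_of_nonneg_left h3 (by positivity)

theorem integrable_norm_sq {g : Euc d → ℂ} (hg : Continuous g) (hgc : HasCompactSupport g) :
    Integrable fun x => ‖g x‖ ^ 2 := by
  refine (hg.norm.pow 2).integrable_of_hasCompactSupport (hgc.mono fun x hx => ?_)
  rw [Function.mem_support] at hx ⊢
  rintro h
  simp [h] at hx

theorem integral_norm_le_of_integral_sq_le {K : Set (Euc d)} (hK : IsCompact K) {g : Euc d → ℂ}
    (hg : Continuous g) (hgs : tsupport g ⊆ K) {τ : ℝ} (hτ : 0 < τ)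
    (h : ∫ x, ‖g x‖ ^ 2 ≤ τ ^ 2) : ∫ x, ‖g x‖ ≤ τ * (volume.real K + 1) := by
  have hgc : HasCompactSupport g := hK.of_isClosed_subset (isClosed_tsupport g) hgs
  have h2 := integrable_norm_sq hg hgc
  have hK' : Integrable (K.indicator fun _ => τ) :=
    (integrable_indicator_iff hK.measurableSet).2 (integrableOn_const hK.measure_lt_top.ne)
  calc ∫ x, ‖g x‖ ≤ ∫ x, (K.indicator (fun _ => τ) x + τ⁻¹ * ‖g x‖ ^ 2) := by
        refine integral_mono (hg.integrable_of_hasCompactSupport hgc).norm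
          (hK'.add (h2.const_mul _)) fun x => ?_
        by_cases hx : x ∈ K
        · simp only [Set.indicator_of_mem hx]
          have : τ * (τ + τ⁻¹ * ‖g x‖ ^ 2 - ‖g x‖) = τ ^ 2 + ‖g x‖ ^ 2 - τ * ‖g x‖ := by
            field_simp
          have h3 : 0 ≤ τ * (τ + τ⁻¹ * ‖g x‖ ^ 2 - ‖g x‖) := by
            rw [this]; nlinarith [sq_nonneg (τ - ‖g x‖), norm_nonneg (g x)]
          linarith [nonneg_of_mul_nonneg_right h3 hτ]
        · have : g x = 0 := image_eq_zero_of_notMem_tsupport fun h => hx (hgs h)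
          simp [Set.indicator_of_notMem hx, this]
    _ = τ * volume.real K + τ⁻¹ * ∫ x, ‖g x‖ ^ 2 := by
        rw [integral_add hK' (h2.const_mul _), integral_const_mul,
          integral_indicator hK.measurableSet, setIntegral_const, smul_eq_mul, mul_comm τ]
    _ ≤ τ * volume.real K + τ⁻¹ * τ ^ 2 := by gcongr
    _ = _ := by field_simp

/-- Smallness in `L²` propagates to all derivatives of a function of class `(M_p)`. -/
theorem exists_norm_mderiv_pow_le {Mp : ℕ → ℝ} (hMpos : ∀ p, 0 < Mp p) {c0 H : ℝ} (hc0 : 1 ≤ c0)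
    (hH : 1 ≤ H) (hM2 : CondM2 Mp c0 H) {K : Set (Euc d)} (hK : IsCompact K) {h : ℝ}
    (hh : 0 < h) :
    ∃ C : ℝ, 0 < C ∧ ∀ (g : Euc d → ℂ) (A τ : ℝ), ContDiff ℝ (⊤ : ℕ∞) g → tsupport g ⊆ K →
      0 < A → 0 < τ → (∀ n x, ‖iteratedFDeriv ℝ n g x‖ ≤ A * h ^ n * Mp n) →
      ∫ x, ‖g x‖ ^ 2 ≤ τ ^ 2 → ∀ (α : Fin d → ℕ) (x : Euc d),
        ‖mderiv α g x‖ ^ (d + 2) ≤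
          C * (A ^ (d + 1) * τ) * ((h * H) ^ (∑ j, α j) * Mp (∑ j, α j)) ^ (d + 2) := by
  set V := volume.real (Metric.ball (0 : Euc d) 1) with hV
  have hV0 : 0 < V := ENNReal.toReal_pos (Metric.measure_ball_pos _ _ one_pos).ne'
    measure_ball_lt_top.ne
  have hM1p := hMpos 1
  refine ⟨4 * (2 * (h * c0 * H * Mp 1)) ^ d * (c0 * (volume.real K + 1)) / V, by positivity,
    fun g A τ hg hgs hA hτ hb hL2 α x => ?_⟩
  have hgc : HasCompactSupport g := hK.of_isClosed_subset (isClosed_tsupport g) hgs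
  rw [mderiv_eq_lderiv]
  set l := indexList (List.finRange d) α with hl
  have hlen : l.length = ∑ j, α j := length_indexList α
  rw [← hlen]
  set n := l.length with hn
  have hMn := hMpos n
  have hMn1 := hMpos (n + 1)
  have hb1 : ∀ x, ‖iteratedFDeriv ℝ (n + 1) g x‖ ≤
      A * (h * c0 * H * Mp 1) * ((h * H) ^ n * Mp n) := fun x => by
    refine (hb (n + 1) x).trans ?_
    have := hM2 n 1
    calc A * h ^ (n + 1) * Mp (n + 1) ≤ A * h ^ (n + 1) * (c0 * H ^ (n + 1) * Mp n * Mp 1) := by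
          gcongr
      _ = _ := by rw [mul_pow]; ring
  have hb2 : ∀ x, ‖iteratedFDeriv ℝ (2 * n) g x‖ ≤ A * c0 * ((h * H) ^ n * Mp n) ^ 2 := fun x => by
    refine (hb (2 * n) x).trans ?_
    have := hM2 n n
    rw [two_mul]
    calc A * h ^ (n + n) * Mp (n + n) ≤ A * h ^ (n + n) * (c0 * H ^ (n + n) * Mp n * Mp n) := by
          gcongr
      _ = _ := by rw [mul_pow, pow_add, pow_add]; ring
  have h1 := integral_norm_lderiv_sq_le l hg hgc hb2
  have h2 := integral_norm_le_of_integral_sq_le hK hg.continuous hgs hτ hL2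
  have h_int := integrable_norm_sq (contDiff_lderiv l hg).continuous
    (hasCompactSupport_lderiv l hgc)
  have h3 := norm_pow_mul_volume_ball_le (by positivity) (norm_lderiv_sub_le l hg hb1) h_int x
  rw [← hV] at h3
  have h4 : ∫ x, ‖lderiv l g x‖ ^ 2 ≤
      A * c0 * ((h * H) ^ n * Mp n) ^ 2 * (τ * (volume.real K + 1)) :=
    h1.trans (mul_le_mul_of_nonneg_left h2 (by positivity))
  set W := (h * H) ^ n * Mp n with hW
  have h5 := h3.trans (mul_le_mul_of_nonneg_left h4 (by positivity))
  rw [← le_div_iff₀ hV0] at h5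
  refine h5.trans (le_of_eq ?_)
  rw [pow_succ A, pow_add W, mul_pow 2, mul_pow (A * _), mul_pow A, mul_pow 2]
  ring

end Interpolation

section AssociatedFunction

variable {Mp : ℕ → ℝ}

theorem logPlus_nonneg (x : ℝ) : 0 ≤ logPlus x := le_max_right _ _

theorem logPlus_le_logPlus {x y : ℝ} (hx : 0 < x) (h : x ≤ y) : logPlus x ≤ logPlus y :=
  max_le_max (Real.log_le_log hx h) le_rfl

theorem bddAbove_logPlus (hMpos : ∀ p, 0 < Mp p) (hM0 : Mp 0 = 1)
    (hs : Summable fun p => (quot Mp p)⁻¹) {ρ : ℝ} (hρ : 0 < ρ) :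
    BddAbove (Set.range fun p : ℕ => logPlus (ρ ^ p / Mp p)) := by
  have hlim : Filter.Tendsto (fun j => ρ / quot Mp j) Filter.atTop (nhds 0) := by
    simpa [div_eq_mul_inv] using hs.tendsto_atTop_zero.const_mul ρ
  obtain ⟨B, -, hB⟩ := exists_prod_range_le_pow
    (fun j => div_nonneg hρ.le (quot_pos hMpos j).le) hlim one_pos
  refine ⟨logPlus B, ?_⟩
  rintro _ ⟨p, rfl⟩
  refine logPlus_le_logPlus (div_pos (pow_pos hρ p) (hMpos p)) ?_
  have := hB p
  rwa [Finset.prod_div_distrib, Finset.prod_const, Finset.card_range, one_pow, mul_one,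
    ← eq_prod_quot hMpos hM0] at this

theorem assocM_nonneg (ρ : ℝ) : 0 ≤ assocM Mp ρ := Real.iSup_nonneg fun _ => logPlus_nonneg _

theorem assocM_mono (hMpos : ∀ p, 0 < Mp p) (hM0 : Mp 0 = 1)
    (hs : Summable fun p => (quot Mp p)⁻¹) {ρ σ : ℝ} (hρ : 0 < ρ) (h : ρ ≤ σ) :
    assocM Mp ρ ≤ assocM Mp σ := by
  refine ciSup_mono (bddAbove_logPlus hMpos hM0 hs (hρ.trans_le h)) fun p => ?_
  have := hMpos p
  exact logPlus_le_logPlus (by positivity) (by gcongr)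

theorem two_mul_assocM_le (hMpos : ∀ p, 0 < Mp p) (hM0 : Mp 0 = 1)
    (hs : Summable fun p => (quot Mp p)⁻¹) {c0 H : ℝ} (hc0 : 1 ≤ c0) (hH : 1 ≤ H)
    (hM2 : CondM2 Mp c0 H) {ρ : ℝ} (hρ : 0 < ρ) :
    2 * assocM Mp ρ ≤ assocM Mp (H * ρ) + Real.log c0 := by
  have hlog := Real.log_nonneg hc0
  have hHρ : 0 < H * ρ := by positivity
  suffices h : assocM Mp ρ ≤ (assocM Mp (H * ρ) + Real.log c0) / 2 by linarith
  refine ciSup_le fun p => max_le ?_ (by linarith [assocM_nonneg (Mp := Mp) (H * ρ)])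
  have h1 := hMpos p
  have h2 := hMpos (p + p)
  have h3 : logPlus ((H * ρ) ^ (p + p) / Mp (p + p)) ≤ assocM Mp (H * ρ) :=
    le_ciSup (bddAbove_logPlus hMpos hM0 hs hHρ) (p + p)
  have h4 : Real.log ((H * ρ) ^ (p + p) / Mp (p + p)) ≤ _ := (le_max_left _ _).trans h3
  have h5 : (ρ ^ p / Mp p) ^ 2 ≤ c0 * ((H * ρ) ^ (p + p) / Mp (p + p)) := by
    rw [div_pow, ← mul_div_assoc, div_le_div_iff₀ (by positivity) h2]
    calc (ρ ^ p) ^ 2 * Mp (p + p) ≤ (ρ ^ p) ^ 2 * (c0 * H ^ (p + p) * Mp p * Mp p) := by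
          gcongr
          exact hM2 p p
      _ = _ := by rw [mul_pow, pow_add ρ]; ring
  have h6 := Real.log_le_log (by positivity) h5
  rw [Real.log_pow, Real.log_mul (by positivity) (by positivity)] at h6
  push_cast at h6
  linarith

theorem two_pow_mul_assocM_le (hMpos : ∀ p, 0 < Mp p) (hM0 : Mp 0 = 1)
    (hs : Summable fun p => (quot Mp p)⁻¹) {c0 H : ℝ} (hc0 : 1 ≤ c0) (hH : 1 ≤ H)
    (hM2 : CondM2 Mp c0 H) {ρ : ℝ} (hρ : 0 < ρ) (J : ℕ) :
    2 ^ J * assocM Mp ρ ≤ assocM Mp (H ^ J * ρ) + (2 ^ J - 1) * Real.log c0 := by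
  induction J with
  | zero => simp
  | succ J ih =>
    have h1 := two_mul_assocM_le hMpos hM0 hs hc0 hH hM2 (ρ := H ^ J * ρ) (by positivity)
    rw [← mul_assoc, ← pow_succ'] at h1
    rw [pow_succ' 2]
    linarith

/-- Condition `(M.2)` allows one to absorb powers of `e^{M(ρ)}` by dilating `ρ`. -/
theorem exists_mul_assocM_le (hMpos : ∀ p, 0 < Mp p) (hM0 : Mp 0 = 1)
    (hs : Summable fun p => (quot Mp p)⁻¹) (hM2 : CondM2' Mp) (m : ℝ) :
    ∃ L : ℝ, 0 < L ∧ ∃ D : ℝ, ∀ ρ, 0 < ρ → m * assocM Mp ρ ≤ assocM Mp (L * ρ) + D := by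
  obtain ⟨c0, H, hc0, hH, hM2⟩ := hM2
  obtain ⟨J, hJ⟩ := pow_unbounded_of_one_lt m (one_lt_two)
  refine ⟨H ^ J, by positivity, (2 ^ J - 1) * Real.log c0, fun ρ hρ => ?_⟩
  exact (mul_le_mul_of_nonneg_right hJ.le (assocM_nonneg ρ)).trans
    (two_pow_mul_assocM_le hMpos hM0 hs hc0 hH hM2 hρ J)

end AssociatedFunction

section Negligibility

open MeasureTheory

variable {d : ℕ} {Mp : ℕ → ℝ}

theorem norm_iteratedFDeriv_conj (n : ℕ) (g : Euc d → ℂ) (x : Euc d) :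
    ‖iteratedFDeriv ℝ n (fun x => (starRingEnd ℂ) (g x)) x‖ = ‖iteratedFDeriv ℝ n g x‖ :=
  Complex.conjLIE.norm_iteratedFDeriv_comp_left g x n

theorem norm_iteratedFDeriv_const_mul (n : ℕ) (c : ℂ) {g : Euc d → ℂ}
    (hg : ContDiff ℝ (⊤ : ℕ∞) g) (x : Euc d) :
    ‖iteratedFDeriv ℝ n (fun x => c * g x) x‖ = ‖c‖ * ‖iteratedFDeriv ℝ n g x‖ := by
  have := iteratedFDeriv_const_smul_apply (𝕜 := ℝ) (i := n) (x := x) (a := c)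
    ((hg.of_le (by exact_mod_cast le_top)).contDiffAt (n := (n : WithTop ℕ∞)) (x := x))
  change ‖iteratedFDeriv ℝ n (c • g) x‖ = _
  rw [this, norm_smul]

theorem IsTestFunction.const_mul {K : Set (Euc d)} {κ : Euc d → ℂ}
    (hκ : IsTestFunction Mp K κ) (c : ℂ) : IsTestFunction Mp K fun x => c * κ x := by
  refine ⟨contDiff_const.mul hκ.1, (closure_mono (Function.support_mul_subset_right _ _)).trans
    hκ.2.1, fun t ht => ?_⟩
  obtain ⟨B, hB⟩ := hκ.2.2 t ht
  refine ⟨‖c‖ * B, fun n x => ?_⟩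
  rw [norm_iteratedFDeriv_const_mul n c hκ.1, mul_assoc, mul_assoc, ← mul_assoc B]
  exact mul_le_mul_of_nonneg_left (hB n x) (norm_nonneg c)

/-- Bounds on all partial derivatives on `K` give bounds on the iterated derivatives of a function
supported in `K`. -/
theorem norm_iteratedFDeriv_le_of_tsupport (hd : 0 < d) (hMpos : ∀ p, 0 < Mp p)
    {K : Set (Euc d)} {g : Euc d → ℂ} (hg : ContDiff ℝ (⊤ : ℕ∞) g) (hgs : tsupport g ⊆ K)
    {h A : ℝ} (hh : 0 < h) (hA : 0 ≤ A)
    (hb : ∀ x ∈ K, ∀ α : Fin d → ℕ,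
      ‖mderiv α g x‖ / ((h / d) ^ (∑ j, α j) * Mp (∑ j, α j)) ≤ A) (n : ℕ) (x : Euc d) :
    ‖iteratedFDeriv ℝ n g x‖ ≤ A * h ^ n * Mp n := by
  have hd' : (0 : ℝ) < d := by exact_mod_cast hd
  have hMn := hMpos n
  by_cases hx : x ∈ K
  · refine (norm_iteratedFDeriv_le_of_mderiv n hg x (B := A * ((h / d) ^ n * Mp n))
      (by positivity) fun α hα => ?_).trans (le_of_eq ?_)
    · have := hb x hx α
      rw [hα] at this
      rwa [div_le_iff₀ (by positivity)] at this
    · rw [div_pow]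
      field_simp
  · rw [iteratedFDeriv_eq_zero_of_notMem hgs hx, norm_zero]
    positivity

theorem integral_mul_conj (g : Euc d → ℂ) :
    ∫ x, g x * (starRingEnd ℂ) (g x) = ((∫ x, ‖g x‖ ^ 2 : ℝ) : ℂ) := by
  rw [← integral_complex_ofReal]
  refine integral_congr_ae (Filter.Eventually.of_forall fun x => ?_)
  simp only [Complex.mul_conj, Complex.normSq_eq_norm_sq]

/-- If `κ` ranges over approximants of the conjugate of `g`, bounds on `∫ g κ` control the `L²`
norm of `g`. -/
theorem integral_norm_sq_le_of_approx {g : Euc d → ℂ} (hg : Continuous g)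
    (hgc : HasCompactSupport g) {R : ℝ}
    (h : ∀ η : ℝ, 0 < η → ∃ κ : Euc d → ℂ, Continuous κ ∧
      (∀ x, ‖κ x - (starRingEnd ℂ) (g x)‖ ≤ η) ∧ ‖∫ x, g x * κ x‖ ≤ R) :
    ∫ x, ‖g x‖ ^ 2 ≤ R := by
  set I := ∫ x, ‖g x‖ with hI
  have hI0 : 0 ≤ I := integral_nonneg fun x => norm_nonneg _
  refine le_of_forall_pos_le_add fun δ hδ => ?_
  obtain ⟨κ, hκ, hap, hb⟩ := h (δ / (I + 1)) (by positivity)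
  have hgi : Integrable g := hg.integrable_of_hasCompactSupport hgc
  have i1 : Integrable fun x => g x * κ x :=
    (hg.mul hκ).integrable_of_hasCompactSupport hgc.mul_right
  have i2 : Integrable fun x => g x * (starRingEnd ℂ) (g x) :=
    (hg.mul (Complex.continuous_conj.comp hg)).integrable_of_hasCompactSupport hgc.mul_right
  have h1 : ‖∫ x, g x * (starRingEnd ℂ) (g x)‖ = ∫ x, ‖g x‖ ^ 2 := by
    rw [integral_mul_conj, Complex.norm_real, Real.norm_eq_abs,
      abs_of_nonneg (integral_nonneg fun x => by positivity)]
  have h2 : ‖∫ x, (g x * κ x - g x * (starRingEnd ℂ) (g x))‖ ≤ ∫ x, δ / (I + 1) * ‖g x‖ := by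
    refine norm_integral_le_of_norm_le (hgi.norm.const_mul _) (Filter.Eventually.of_forall
      fun x => ?_)
    rw [← mul_sub, norm_mul, mul_comm]
    exact mul_le_mul_of_nonneg_right (hap x) (norm_nonneg _)
  rw [integral_sub i1 i2, integral_const_mul] at h2
  have h3 : δ / (I + 1) * I ≤ δ := by
    rw [div_mul_eq_mul_div, div_le_iff₀ (by positivity)]
    nlinarith
  rw [← h1]
  have h4 := norm_sub_norm_le (∫ x, g x * (starRingEnd ℂ) (g x)) (∫ x, g x * κ x)
  rw [norm_sub_rev] at h4
  linarith

end Negligibility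

section Main

open MeasureTheory

variable {d : ℕ} {Mp : ℕ → ℝ}

/-- The case in which the class is non-quasianalytic. -/
theorem negligible_of_summable (hd : 0 < d) (hMpos : ∀ p, 0 < Mp p) (hM0 : Mp 0 = 1)
    (hM1 : CondM1 Mp) (hM2 : CondM2' Mp) (hM3 : CondM3 Mp)
    (hs : Summable fun p => (quot Mp p)⁻¹) {K : Set (Euc d)} (hK : IsCompact K)
    {f : ℝ → Euc d → ℂ} (hsmooth : ∀ ε ∈ Set.Ioo (0 : ℝ) 1, ContDiff ℝ (⊤ : ℕ∞) (f ε))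
    (hsupp : ∀ ε ∈ Set.Ioo (0 : ℝ) 1, tsupport (f ε) ⊆ K) {s : ℝ} (hs0 : 0 < s)
    (hreg : ∀ h : ℝ, 0 < h → ∃ C : ℝ, 0 < C ∧ ∃ ε₁ ∈ Set.Ioo (0 : ℝ) 1,
      ∀ ε : ℝ, 0 < ε → ε < ε₁ → ∀ n x,
        ‖iteratedFDeriv ℝ n (f ε) x‖ ≤ C * Real.exp (assocM Mp (s / ε)) * h ^ n * Mp n)
    (hweak : ∀ h : ℝ, 0 < h → ∀ κ : Euc d → ℂ, IsTestFunction Mp K κ →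
      ∃ ε₀ : ℝ, 0 < ε₀ ∧ ∃ C : ℝ, ∀ ε : ℝ, 0 < ε → ε < ε₀ →
        ‖∫ x, f ε x * κ x‖ * Real.exp (assocM Mp (h / ε)) ≤ C)
    {h k : ℝ} (hh : 0 < h) (hk : 0 < k) :
    ∃ C : ℝ, 0 < C ∧ ∃ ε₀ ∈ Set.Ioo (0 : ℝ) 1, ∀ ε : ℝ, 0 < ε → ε < ε₀ →
      ∀ (x : Euc d) (α : Fin d → ℕ), ‖mderiv α (f ε) x‖ ≤
        C * Real.exp (-assocM Mp (k / ε)) * (h ^ (∑ j, α j) * Mp (∑ j, α j)) := by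
  obtain ⟨L, hL, D, hLD⟩ := exists_mul_assocM_le hMpos hM0 hs hM2 (4 * d + 8)
  have hfc : ∀ ε ∈ Set.Ioo (0 : ℝ) 1, HasCompactSupport (f ε) := fun ε hε =>
    hK.of_isClosed_subset (isClosed_tsupport _) (hsupp ε hε)
  set r := max s k with hr
  have hr0 : 0 < r := lt_max_of_lt_left hs0
  obtain ⟨N, hN⟩ := exists_uniform_bound hMpos hM0 hK (fun ε hε => (hsmooth ε hε).continuous) hfc
    (w := fun ε => Real.exp (assocM Mp (L * r / ε))) (fun ε => (Real.exp_pos _).le)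
    (hweak (L * r) (by positivity))
  have hN0 : 0 < 1 / ((N : ℝ) + 1) := by positivity
  obtain ⟨h₁, hh₁, C₁, hC₁, happ⟩ := exists_test_approx hd hMpos hM0 hM1 hM2 hM3 hs hK hN0
  obtain ⟨A₁, hA₁, ε₁, hε₁, hreg₁⟩ := hreg h₁ hh₁
  obtain ⟨c0, H, hc0, hH, hM2⟩ := hM2
  have hH0 : 0 < H := by linarith
  obtain ⟨A₂, hA₂, ε₂, hε₂, hreg₂⟩ := hreg (h / H) (by positivity)
  obtain ⟨C₂, hC₂, h_int⟩ := exists_norm_mderiv_pow_le hMpos hc0 hH hM2 hK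
    (h := h / H) (by positivity)
  set T := A₁ * C₁ * (N + 1) * Real.exp D + 1 with hT
  have hT1 : 1 ≤ T := by rw [hT]; linarith [show 0 < A₁ * C₁ * (N + 1) * Real.exp D by positivity]
  set B := C₂ * (A₂ ^ (d + 1) * T) + 1 with hB
  have hB1 : 1 ≤ B := by rw [hB]; linarith [show 0 < C₂ * (A₂ ^ (d + 1) * T) by positivity]
  refine ⟨B, by linarith, min (min ε₁ ε₂) (1 / ((N : ℝ) + 1)), ⟨by
    simp only [lt_min_iff]; exact ⟨⟨hε₁.1, hε₂.1⟩, hN0⟩, by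
    simp only [min_lt_iff]; exact Or.inl (Or.inl hε₁.2)⟩, fun ε hε hlt x α => ?_⟩
  simp only [lt_min_iff] at hlt
  obtain ⟨⟨hl1, hl2⟩, hl3⟩ := hlt
  have hεI : ε ∈ Set.Ioo (0 : ℝ) 1 := ⟨hε, hl1.trans hε₁.2⟩
  have hsm := hsmooth ε hεI
  have hsu := hsupp ε hεI
  set a := assocM Mp (r / ε) with ha
  have ha0 : 0 ≤ a := assocM_nonneg _
  have has : assocM Mp (s / ε) ≤ a := assocM_mono hMpos hM0 hs (by positivity) (by
    gcongr; exact le_max_left _ _)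
  have hak : assocM Mp (k / ε) ≤ a := assocM_mono hMpos hM0 hs (by positivity) (by
    gcongr; exact le_max_right _ _)
  have haL : (4 * d + 8) * a ≤ assocM Mp (L * r / ε) + D := by
    rw [mul_div_assoc]; exact hLD _ (by positivity)
  have hM := hMpos
  set R := A₁ * Real.exp a with hR
  have hR0 : 0 < R := by positivity
  have hL2 : ∫ x, ‖f ε x‖ ^ 2 ≤ R * C₁ * ((N + 1) / Real.exp (assocM Mp (L * r / ε))) := by
    refine integral_norm_sq_le_of_approx hsm.continuous (hfc ε hεI) fun η hη => ?_
    obtain ⟨κ, hκ, hκb, hκa⟩ := happ (fun x => ((R⁻¹ : ℝ) : ℂ) * (starRingEnd ℂ) (f ε x))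
      (contDiff_const.mul (contDiff_conj hsm))
      ((closure_mono fun x hx => by
        rw [Function.mem_support] at hx ⊢
        rintro h0
        simp [h0] at hx).trans hsu)
      (fun n x => by
        rw [norm_iteratedFDeriv_const_mul n _ (contDiff_conj hsm), norm_iteratedFDeriv_conj,
          Complex.norm_real, Real.norm_eq_abs, abs_of_pos (by positivity),
          inv_mul_le_iff₀ hR0, ← mul_assoc]
        refine (hreg₁ ε hε hl1 n x).trans ?_
        have := hM n
        rw [hR]
        gcongr) (η / R) (by positivity)
    refine ⟨fun x => ((R : ℝ) : ℂ) * κ x, continuous_const.mul hκ.1.continuous, fun x => ?_, ?_⟩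
    · have e : (R : ℂ) * κ x - (starRingEnd ℂ) (f ε x) =
          (R : ℂ) * (κ x - ((R⁻¹ : ℝ) : ℂ) * (starRingEnd ℂ) (f ε x)) := by
        have : (R : ℂ) ≠ 0 := by exact_mod_cast hR0.ne'
        push_cast
        field_simp
      rw [e, norm_mul, Complex.norm_real, Real.norm_eq_abs, abs_of_pos hR0]
      exact (mul_le_mul_of_nonneg_left (hκa x) hR0.le).trans (le_of_eq (by field_simp))
    · have h1 := hN ε hε hl3 _ (hκ.const_mul ((C₁⁻¹ : ℝ) : ℂ)) fun n x => by
        rw [norm_iteratedFDeriv_const_mul n _ hκ.1, Complex.norm_real, Real.norm_eq_abs,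
          abs_of_pos (by positivity), inv_mul_le_iff₀ hC₁, ← mul_assoc]
        exact hκb n x
      have e1 : ∀ c : ℂ, ∫ x, f ε x * (c * κ x) = c * ∫ x, f ε x * κ x := fun c => by
        rw [← integral_const_mul]
        exact integral_congr_ae (Filter.Eventually.of_forall fun x => by ring)
      simp only [e1, norm_mul, Complex.norm_real, Real.norm_eq_abs, abs_of_pos hR0,
        abs_of_pos (inv_pos.2 hC₁)] at h1 ⊢
      rw [← le_div_iff₀ (Real.exp_pos _), inv_mul_le_iff₀ hC₁] at h1
      rw [mul_assoc R]
      exact mul_le_mul_of_nonneg_left h1 hR0.le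
  have hτ : ∫ x, ‖f ε x‖ ^ 2 ≤ (T * Real.exp (-((2 * d + 3) * a))) ^ 2 := by
    have e1 : 1 / Real.exp (assocM Mp (L * r / ε)) ≤
        Real.exp D * Real.exp (-((4 * d + 8) * a)) := by
      rw [one_div, ← Real.exp_neg, ← Real.exp_add, Real.exp_le_exp]
      linarith
    have e2 : Real.exp a * Real.exp (-((4 * d + 8) * a)) ≤
        Real.exp (-((2 * d + 3) * a)) ^ 2 := by
      rw [← Real.exp_add, ← Real.exp_nat_mul, Real.exp_le_exp]
      push_cast
      nlinarith
    calc ∫ x, ‖f ε x‖ ^ 2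
        ≤ A₁ * C₁ * (N + 1) * (Real.exp a * (1 / Real.exp (assocM Mp (L * r / ε)))) :=
          hL2.trans (le_of_eq (by rw [hR]; ring))
      _ ≤ A₁ * C₁ * (N + 1) * (Real.exp a * (Real.exp D * Real.exp (-((4 * d + 8) * a)))) := by
          gcongr
      _ = A₁ * C₁ * (N + 1) * Real.exp D * (Real.exp a * Real.exp (-((4 * d + 8) * a))) := by ring
      _ ≤ T ^ 2 * Real.exp (-((2 * d + 3) * a)) ^ 2 := by
          refine mul_le_mul ?_ e2 (by positivity) (by positivity)
          nlinarith
      _ = _ := by rw [mul_pow]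
  have hfin := h_int (f ε) (A₂ * Real.exp a) (T * Real.exp (-((2 * d + 3) * a))) hsm hsu
    (by positivity) (by positivity) (fun n x => by
      refine (hreg₂ ε hε hl2 n x).trans ?_
      have := hM n
      gcongr) hτ α x
  rw [div_mul_cancel₀ _ hH0.ne'] at hfin
  set n := ∑ j, α j
  have hMn := hM n
  have e3 : Real.exp a ^ (d + 1) * Real.exp (-((2 * d + 3) * a)) = Real.exp (-a) ^ (d + 2) := by
    rw [← Real.exp_nat_mul, ← Real.exp_nat_mul, ← Real.exp_add]
    congr 1
    push_cast
    ring
  have e4 : ‖mderiv α (f ε) x‖ ^ (d + 2) ≤ (B * Real.exp (-a) * (h ^ n * Mp n)) ^ (d + 2) := by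
    refine hfin.trans ?_
    rw [mul_pow (B * _), mul_pow B, mul_pow A₂]
    calc _ = C₂ * (A₂ ^ (d + 1) * T) *
          (Real.exp a ^ (d + 1) * Real.exp (-((2 * d + 3) * a))) * (h ^ n * Mp n) ^ (d + 2) := by
          ring
      _ ≤ _ := by
          rw [e3]
          gcongr
          exact (by rw [hB]; linarith : C₂ * (A₂ ^ (d + 1) * T) ≤ B).trans
            (le_self_pow₀ hB1 (by omega))
  refine (le_of_pow_le_pow_left₀ (by omega) (by positivity) e4).trans ?_
  gcongr

/-- In the quasianalytic case a function of class `(M_p)` with compact support vanishes. -/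
theorem eq_zero_of_not_summable_of_bound (hd : 0 < d) (hMpos : ∀ p, 0 < Mp p)
    (hM1 : CondM1 Mp) (hns : ¬ Summable fun p => (quot Mp p)⁻¹) {K : Set (Euc d)}
    (hK : IsCompact K) {g : Euc d → ℂ} (hg : ContDiff ℝ (⊤ : ℕ∞) g) (hgs : tsupport g ⊆ K)
    {A : ℝ} (hA : 0 < A) (hb : ∀ n x, ‖iteratedFDeriv ℝ n g x‖ ≤ A * 1 ^ n * Mp n) : g = 0 := by
  obtain ⟨x₀, hx₀⟩ := nonempty_compl_of_isCompact hd hK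
  funext y
  refine eq_zero_of_not_summable (Mp := fun n => A * Mp n) (fun p => mul_pos hA (hMpos p))
    (fun p => ?_) ?_ hg (fun n x => by simpa using hb n x)
    (fun n => iteratedFDeriv_eq_zero_of_notMem hgs hx₀ n) y
  · have := mul_le_mul_of_nonneg_left (hM1 p) (sq_nonneg A)
    simp only
    nlinarith
  · convert hns using 4 with p
    exact mul_div_mul_left _ _ hA.ne'

theorem mderiv_zero (α : Fin d → ℕ) : mderiv α (0 : Euc d → ℂ) = 0 := by
  funext x
  have h : ContDiff ℝ (⊤ : ℕ∞) (0 : Euc d → ℂ) := contDiff_const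
  have := norm_mderiv_le α h x
  rw [show iteratedFDeriv ℝ (∑ j, α j) (0 : Euc d → ℂ) = 0 from iteratedFDeriv_fun_zero] at this
  simpa using this

end Main

section DimensionZero

theorem mderiv_dim_zero (α : Fin 0 → ℕ) (f : Euc 0 → ℂ) : mderiv α f = f := by
  simp [mderiv]

/-- The zero-dimensional case, where test functions are constants. -/
theorem negligibleB_of_dim_zero (Mp : ℕ → ℝ) (hM0 : Mp 0 = 1) {K : Set (Euc 0)}
    (f : ℝ → Euc 0 → ℂ) (hsupp : ∀ ε ∈ Set.Ioo (0 : ℝ) 1, tsupport (f ε) ⊆ K)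
    (hweak : ∀ h : ℝ, 0 < h → ∀ κ : Euc 0 → ℂ, ContDiff ℝ (⊤ : ℕ∞) κ → tsupport κ ⊆ K →
      (∀ lam : ℝ, 0 < lam → ∃ B : ℝ, ∀ (x : Euc 0) (α : Fin 0 → ℕ),
        ‖mderiv α κ x‖ ≤ B * lam ^ (∑ j, α j) * Mp (∑ j, α j)) →
      ∃ ε₀ ∈ Set.Ioo (0 : ℝ) 1, ∃ C : ℝ, 0 < C ∧ ∀ ε : ℝ, 0 < ε → ε < ε₀ →
        ‖∫ x : Euc 0, f ε x * κ x‖ * Real.exp (assocM Mp (h / ε)) ≤ C) :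
    NegligibleB Mp f := by
  intro K' _ h _ k hk
  simp only [mderiv_dim_zero, Finset.univ_eq_empty, Finset.sum_empty, pow_zero, hM0, mul_one,
    div_one]
  rcases K.eq_empty_or_nonempty with rfl | ⟨y, hy⟩
  · refine ⟨1, one_pos, 1 / 2, by norm_num, fun ε hε hlt x _ _ => ?_⟩
    have h0 : f ε x = 0 := image_eq_zero_of_notMem_tsupport fun hx =>
      hsupp ε ⟨hε, by linarith⟩ hx
    rw [h0, norm_zero]
    positivity
  · obtain ⟨ε₀, hε₀, C, hC, hb⟩ := hweak k hk (fun _ => 1) contDiff_const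
      (fun x _ => Subsingleton.elim y x ▸ hy) fun lam _ => ⟨1, fun x α => by
        simp [mderiv_dim_zero, hM0]⟩
    refine ⟨C, hC, ε₀, hε₀, fun ε hε hlt x _ _ => ?_⟩
    have h1 := hb ε hε hlt
    have h2 : ∫ x : Euc 0, f ε x * 1 = f ε x := by
      rw [volume_euclideanSpace_eq_dirac, MeasureTheory.integral_dirac, mul_one,
        Subsingleton.elim 0 x]
    rw [h2] at h1
    rwa [Real.exp_neg, ← div_eq_mul_inv, le_div_iff₀ (Real.exp_pos _)]

end DimensionZero

theorem stmt17 {d : ℕ} (Mp : ℕ → ℝ) (hMpos : ∀ p, 0 < Mp p) (hM0 : Mp 0 = 1)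
    (hM1 : CondM1 Mp) (hM2 : CondM2' Mp) (hM3 : CondM3 Mp)
    (K : Set (EuclideanSpace ℝ (Fin d))) (hK : IsCompact K)
    (f : ℝ → EuclideanSpace ℝ (Fin d) → ℂ)
    (hsmooth : ∀ ε ∈ Set.Ioo (0 : ℝ) 1, ContDiff ℝ (⊤ : ℕ∞) (f ε))
    (hsupp : ∀ ε ∈ Set.Ioo (0 : ℝ) 1, tsupport (f ε) ⊆ K)
    (hreg : ∃ s : ℝ, 0 < s ∧ ∀ h : ℝ, 0 < h → ∃ C : ℝ, 0 < C ∧ ∃ ε₁ ∈ Set.Ioo (0 : ℝ) 1,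
      ∀ ε : ℝ, 0 < ε → ε < ε₁ → ∀ x ∈ K, ∀ α : Fin d → ℕ,
        ‖mderiv α (f ε) x‖ / (h ^ (∑ j, α j) * Mp (∑ j, α j)) ≤
          C * Real.exp (assocM Mp (s / ε)))
    (hweak : ∀ h : ℝ, 0 < h →
      ∀ κ : EuclideanSpace ℝ (Fin d) → ℂ, ContDiff ℝ (⊤ : ℕ∞) κ → tsupport κ ⊆ K →
        (∀ lam : ℝ, 0 < lam → ∃ B : ℝ, ∀ (x : EuclideanSpace ℝ (Fin d)) (α : Fin d → ℕ),
          ‖mderiv α κ x‖ ≤ B * lam ^ (∑ j, α j) * Mp (∑ j, α j)) →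
        ∃ ε₀ ∈ Set.Ioo (0 : ℝ) 1, ∃ C : ℝ, 0 < C ∧ ∀ ε : ℝ, 0 < ε → ε < ε₀ →
          ‖∫ x : EuclideanSpace ℝ (Fin d), f ε x * κ x‖ * Real.exp (assocM Mp (h / ε)) ≤ C) :
    NegligibleB Mp f := by
  obtain ⟨s, hs0, hreg⟩ := hreg
  rcases Nat.eq_zero_or_pos d with rfl | hd
  · exact negligibleB_of_dim_zero Mp hM0 f hsupp fun h hh κ hκ hκs hκb => by
      obtain ⟨ε₀, hε₀, C, hC, hb⟩ := hweak h hh κ hκ hκs hκb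
      exact ⟨ε₀, hε₀, C, hC, hb⟩
  have hd' : (0 : ℝ) < d := by exact_mod_cast hd
  have hreg' : ∀ h : ℝ, 0 < h → ∃ C : ℝ, 0 < C ∧ ∃ ε₁ ∈ Set.Ioo (0 : ℝ) 1,
      ∀ ε : ℝ, 0 < ε → ε < ε₁ → ∀ n x,
        ‖iteratedFDeriv ℝ n (f ε) x‖ ≤ C * Real.exp (assocM Mp (s / ε)) * h ^ n * Mp n := by
    intro h hh
    obtain ⟨C, hC, ε₁, hε₁, hb⟩ := hreg (h / d) (by positivity)
    refine ⟨C, hC, ε₁, hε₁, fun ε hε hlt => ?_⟩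
    have hεI : ε ∈ Set.Ioo (0 : ℝ) 1 := ⟨hε, hlt.trans hε₁.2⟩
    exact norm_iteratedFDeriv_le_of_tsupport hd hMpos (hsmooth ε hεI) (hsupp ε hεI) hh
      (by positivity) (hb ε hε hlt)
  have hweak' : ∀ h : ℝ, 0 < h → ∀ κ : Euc d → ℂ, IsTestFunction Mp K κ →
      ∃ ε₀ : ℝ, 0 < ε₀ ∧ ∃ C : ℝ, ∀ ε : ℝ, 0 < ε → ε < ε₀ →
        ‖∫ x, f ε x * κ x‖ * Real.exp (assocM Mp (h / ε)) ≤ C := by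
    intro h hh κ hκ
    obtain ⟨ε₀, hε₀, C, -, hb⟩ := hweak h hh κ hκ.1 hκ.2.1 fun lam hlam => by
      obtain ⟨B, hB⟩ := hκ.2.2 lam hlam
      exact ⟨B, fun x α => (norm_mderiv_le α hκ.1 x).trans (hB _ x)⟩
    exact ⟨ε₀, hε₀.1, C, hb⟩
  intro K' _ h hh k hk
  by_cases hs : Summable fun p => (quot Mp p)⁻¹
  · obtain ⟨C, hC, ε₀, hε₀, hb⟩ := negligible_of_summable hd hMpos hM0 hM1 hM2 hM3 hs hK hsmooth
      hsupp hs0 hreg' hweak' hh hk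
    refine ⟨C, hC, ε₀, hε₀, fun ε hε hlt x _ α => ?_⟩
    have := hMpos (∑ j, α j)
    rw [div_le_iff₀ (by positivity)]
    exact hb ε hε hlt x α
  · obtain ⟨C, hC, ε₁, hε₁, hb⟩ := hreg' 1 one_pos
    refine ⟨1, one_pos, ε₁, hε₁, fun ε hε hlt x _ α => ?_⟩
    have hεI : ε ∈ Set.Ioo (0 : ℝ) 1 := ⟨hε, hlt.trans hε₁.2⟩
    rw [eq_zero_of_not_summable_of_bound hd hMpos hM1 hs hK (hsmooth ε hεI) (hsupp ε hεI)
      (by positivity) (hb ε hε hlt), mderiv_zero, Pi.zero_apply, norm_zero, zero_div]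
    positivity
end

section
/- Let (f_ε)_{ε∈(0,1)} be a family of continuous functions f_ε : ℝ^d → ℂ. Assume that for every R ∈ ℤ_+, every p ∈ ℤ_+ and every x ∈ ℝ^d there exists l ∈ ℤ_+ such that sup_{t∈ℝ^d, |t|≤R} |f_ε(x+t) − f_ε(t)| ≤ e^{−M(p/ε)} for all ε < 1/l. Then for every R ∈ ℤ_+ and every p ∈ ℤ_+ there exist C > 0 and ε_0 ∈ (0,1) such that sup_{t∈ℝ^d, |t|≤R} |f_ε(t) − f_ε(0)| ≤ C·e^{−M(p/ε)} for all ε < ε_0. (In the language of generalized Beurling ultradistributions: a translation invariant generalized ultradistribution equals a generalized constant.) -/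
open scoped BigOperators

/-- If every translate of `g ε` is close to `g ε` on a set `B` for all small `ε`, then, by the Baire
category theorem, this holds uniformly for translates in some ball. -/
theorem exists_ball_forall_translate_le {E F : Type*} [NormedAddCommGroup E] [CompleteSpace E]
    [NormedAddCommGroup F] (g : ℝ → E → F) (hg : ∀ ε ∈ Set.Ioo (0 : ℝ) 1, Continuous (g ε))
    (b : ℝ → ℝ) (B : Set E)
    (h : ∀ x : E, ∃ l : ℕ, 0 < l ∧ ∀ ε : ℝ, 0 < ε → ε < 1 / (l : ℝ) →
      ∀ t ∈ B, ‖g ε (x + t) - g ε t‖ ≤ b ε) :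
    ∃ x₀ : E, ∃ r > 0, ∃ ε₀ ∈ Set.Ioo (0 : ℝ) 1, ∀ x ∈ Metric.ball x₀ r,
      ∀ ε : ℝ, 0 < ε → ε < ε₀ → ∀ t ∈ B, ‖g ε (x + t) - g ε t‖ ≤ b ε := by
  set A : ℕ → Set E := fun l => ⋂ ε ∈ Set.Ioo (0 : ℝ) (1 / ((l : ℝ) + 2)), ⋂ t ∈ B,
    {x | ‖g ε (x + t) - g ε t‖ ≤ b ε} with hA
  have hpos : ∀ l : ℕ, (0 : ℝ) < l + 2 := fun l => by positivity
  have hlt : ∀ l : ℕ, 1 / ((l : ℝ) + 2) < 1 := fun l => by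
    rw [div_lt_one (hpos l)]
    linarith [(Nat.cast_nonneg l : (0 : ℝ) ≤ l)]
  have hclosed : ∀ l, IsClosed (A l) := fun l => by
    refine isClosed_biInter fun ε hε => isClosed_biInter fun t _ => ?_
    have hc := hg ε ⟨hε.1, hε.2.trans (hlt l)⟩
    exact isClosed_le (by fun_prop) continuous_const
  have hunion : ⋃ l, A l = Set.univ := by
    refine Set.eq_univ_of_forall fun x => ?_
    obtain ⟨l, hl, hx⟩ := h x
    refine Set.mem_iUnion.2 ⟨l, ?_⟩
    simp only [hA, Set.mem_iInter]
    intro ε hε t ht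
    refine hx ε hε.1 (hε.2.trans_le ?_) t ht
    exact one_div_le_one_div_of_le (by exact_mod_cast hl) (by linarith)
  obtain ⟨l, x₀, hx₀⟩ := nonempty_interior_of_iUnion_of_closed hclosed hunion
  obtain ⟨r, hr, hball⟩ := Metric.isOpen_iff.1 isOpen_interior x₀ hx₀
  refine ⟨x₀, r, hr, 1 / ((l : ℝ) + 2), ⟨one_div_pos.2 (hpos l), hlt l⟩, ?_⟩
  intro x hx ε hε hε' t ht
  have hxA := interior_subset (hball hx)
  simp only [hA, Set.mem_iInter] at hxA
  exact hxA ε ⟨hε, hε'⟩ t ht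

/-- Bounds on small increments within a ball add up along a segment issuing from the centre. -/
theorem norm_sub_le_of_small_increments {E F : Type*} [NormedAddCommGroup E] [NormedSpace ℝ E]
    [NormedAddCommGroup F] (g : E → F) {R r b : ℝ} {N : ℕ} (hN : 0 < N) (hNr : R / N < r)
    (h : ∀ s y : E, ‖s‖ ≤ R → ‖y + s‖ ≤ R → ‖y‖ < r → ‖g (y + s) - g s‖ ≤ b)
    {t : E} (ht : ‖t‖ ≤ R) : ‖g t - g 0‖ ≤ N * b := by
  have hN' : (0 : ℝ) < N := by exact_mod_cast hN
  have hmem : ∀ k : ℕ, k ≤ N → ‖((k : ℝ) / N) • t‖ ≤ R := fun k hk => by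
    rw [norm_smul, Real.norm_of_nonneg (by positivity)]
    have : (k : ℝ) / N ≤ 1 := by
      rw [div_le_one hN']
      exact_mod_cast hk
    exact (mul_le_of_le_one_left (norm_nonneg t) this).trans ht
  have hstep : ∀ k : ℕ, (1 / (N : ℝ)) • t + ((k : ℝ) / N) • t = (((k + 1 : ℕ) : ℝ) / N) • t :=
    fun k => by
      rw [← add_smul]
      congr 1
      push_cast
      ring
  have hy : ‖(1 / (N : ℝ)) • t‖ < r := by
    rw [norm_smul, Real.norm_of_nonneg (by positivity), one_div_mul_eq_div]
    exact (div_le_div_of_nonneg_right ht hN'.le).trans_lt hNr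
  have hsum : ∀ k : ℕ, k ≤ N → ‖g (((k : ℝ) / N) • t) - g 0‖ ≤ k * b := by
    intro k
    induction k with
    | zero => simp
    | succ k ih =>
      intro hk
      have h₁ := h (((k : ℝ) / N) • t) ((1 / (N : ℝ)) • t) (hmem k (by omega))
        (by rw [hstep]; exact hmem _ hk) hy
      rw [hstep] at h₁
      have h₂ := norm_sub_le_norm_sub_add_norm_sub (g ((((k + 1 : ℕ) : ℝ) / N) • t))
        (g (((k : ℝ) / N) • t)) (g 0)
      have h₃ := ih (by omega)
      push_cast at h₁ h₂ ⊢
      linarith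
  simpa [div_self hN'.ne'] using hsum N le_rfl

theorem stmt18 {d : ℕ} (Mp : ℕ → ℝ) (hMpos : ∀ p, 0 < Mp p) (hM0 : Mp 0 = 1)
    (hM1 : CondM1 Mp) (hM2 : CondM2' Mp) (hM3 : CondM3 Mp)
    (f : ℝ → EuclideanSpace ℝ (Fin d) → ℂ)
    (hcont : ∀ ε ∈ Set.Ioo (0 : ℝ) 1, Continuous (f ε))
    (hyp : ∀ R : ℕ, 0 < R → ∀ p : ℕ, 0 < p → ∀ x : EuclideanSpace ℝ (Fin d),
      ∃ l : ℕ, 0 < l ∧ ∀ ε : ℝ, 0 < ε → ε < 1 / (l : ℝ) →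
        ∀ t : EuclideanSpace ℝ (Fin d), ‖t‖ ≤ (R : ℝ) →
          ‖f ε (x + t) - f ε t‖ ≤ Real.exp (-assocM Mp ((p : ℝ) / ε))) :
    ∀ R : ℕ, 0 < R → ∀ p : ℕ, 0 < p → ∃ C : ℝ, 0 < C ∧ ∃ ε₀ ∈ Set.Ioo (0 : ℝ) 1,
      ∀ ε : ℝ, 0 < ε → ε < ε₀ → ∀ t : EuclideanSpace ℝ (Fin d), ‖t‖ ≤ (R : ℝ) →
        ‖f ε t - f ε 0‖ ≤ C * Real.exp (-assocM Mp ((p : ℝ) / ε)) := by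
  intro R hR p hp
  obtain ⟨x₀, r, hr, ε₀, hε₀, h⟩ := exists_ball_forall_translate_le f hcont
    (fun ε => Real.exp (-assocM Mp ((p : ℝ) / ε))) {t | ‖t‖ ≤ (R : ℝ)} (hyp R hR p hp)
  obtain ⟨N, hN⟩ := exists_nat_gt ((R : ℝ) / r)
  have hN' : (0 : ℝ) < N := lt_of_le_of_lt (by positivity) hN
  refine ⟨N * 2, by positivity, ε₀, hε₀, fun ε hε hε' t ht => ?_⟩
  rw [mul_assoc]
  refine norm_sub_le_of_small_increments (f ε) (by exact_mod_cast hN')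
    ((div_lt_comm₀ hr hN').1 hN) (fun s y hs hys hy => ?_) ht
  have h₁ := h x₀ (Metric.mem_ball_self hr) ε hε hε' (y + s) hys
  have h₂ := h (x₀ + y) (by simpa using hy) ε hε hε' s hs
  rw [add_assoc] at h₂
  rw [norm_sub_rev] at h₁
  linarith [norm_sub_le_norm_sub_add_norm_sub (f ε (y + s)) (f ε (x₀ + (y + s))) (f ε s)]
end

section
/- Let (f_ε)_{ε∈(0,1)} be a family of continuous functions f_ε : ℝ^d → ℂ. Assume that for every R ∈ ℤ_+, every (p_i) ∈ 𝕽 and every x ∈ ℝ^d there exists l ∈ ℤ_+ such that sup_{t∈ℝ^d, |t|≤R} |f_ε(x+t) − f_ε(t)| ≤ e^{−N_{(p_i)}(1/ε)} for all ε < 1/l. Then for every R ∈ ℤ_+ and every (p_i) ∈ 𝕽 there exist C > 0 and ε_0 ∈ (0,1) such that sup_{t∈ℝ^d, |t|≤R} |f_ε(t) − f_ε(0)| ≤ C·e^{−N_{(p_i)}(1/ε)} for all ε < ε_0. (In the language of generalized Roumieu ultradistributions: a translation invariant generalized ultradistribution equals a generalized constant.) -/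
open scoped BigOperators

/-- Baire category argument: if a family of continuous functions satisfies pointwise-in-`x` bounds
on the increments `f ε (x + t) - f ε t`, then the increments over small `x` obey a uniform bound. -/
theorem exists_uniform_increment_bound {E F : Type*} [NormedAddCommGroup E] [CompleteSpace E]
    [SeminormedAddCommGroup F] (f : ℝ → E → F) (g : ℝ → ℝ) (R : ℝ)
    (hcont : ∀ ε ∈ Set.Ioo (0 : ℝ) 1, Continuous (f ε))
    (hyp : ∀ x : E, ∃ l : ℕ, 0 < l ∧ ∀ ε : ℝ, 0 < ε → ε < 1 / (l : ℝ) →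
      ∀ t : E, ‖t‖ ≤ R + 1 → ‖f ε (x + t) - f ε t‖ ≤ g ε) :
    ∃ δ : ℝ, 0 < δ ∧ ∃ l : ℕ, 0 < l ∧ ∀ ε : ℝ, 0 < ε → ε < 1 / (l : ℝ) →
      ∀ x t : E, ‖x‖ < δ → ‖t‖ ≤ R → ‖f ε (x + t) - f ε t‖ ≤ 2 * g ε := by
  let A : ℕ → Set E := fun l ↦ {x | ∀ ε : ℝ, 0 < ε → ε < 1 / ((l + 1 : ℕ) : ℝ) →
    ∀ t : E, ‖t‖ ≤ R + 1 → ‖f ε (x + t) - f ε t‖ ≤ g ε}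
  have hclosed : ∀ l, IsClosed (A l) := by
    intro l
    simp only [A, Set.ofPred_forall]
    refine isClosed_iInter fun ε ↦ isClosed_iInter fun hε ↦ isClosed_iInter fun hεl ↦
      isClosed_iInter fun t ↦ isClosed_iInter fun _ ↦ ?_
    have hl : 1 / ((l + 1 : ℕ) : ℝ) ≤ 1 := by
      push_cast
      exact div_le_one_of_le₀ (by linarith [Nat.cast_nonneg (α := ℝ) l]) (by positivity)
    have hf := hcont ε ⟨hε, hεl.trans_le hl⟩
    exact isClosed_le (by fun_prop) continuous_const
  have hcover : ⋃ l, A l = Set.univ := by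
    refine Set.eq_univ_of_forall fun x ↦ ?_
    obtain ⟨l, hl, h⟩ := hyp x
    obtain ⟨k, rfl⟩ := Nat.exists_eq_succ_of_ne_zero hl.ne'
    exact Set.mem_iUnion.2 ⟨k, h⟩
  obtain ⟨l, x₀, hx₀⟩ := nonempty_interior_of_iUnion_of_closed hclosed hcover
  obtain ⟨δ, hδ, hball⟩ := Metric.isOpen_iff.1 isOpen_interior x₀ hx₀
  refine ⟨min δ 1, lt_min hδ one_pos, l + 1, l.succ_pos, fun ε hε hεl x t hx ht ↦ ?_⟩
  have hmem : x₀ + x ∈ A l := by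
    refine interior_subset (hball ?_)
    simpa [dist_eq_norm] using hx.trans_le (min_le_left _ _)
  have hxt : ‖x + t‖ ≤ R + 1 := by
    linarith [norm_add_le x t, hx.trans_le (min_le_right δ 1)]
  have h₁ := hmem ε hε hεl t (by linarith)
  have h₂ := interior_subset hx₀ ε hε hεl (x + t) hxt
  rw [add_assoc] at h₁
  calc ‖f ε (x + t) - f ε t‖
      = ‖(f ε (x₀ + (x + t)) - f ε t) - (f ε (x₀ + (x + t)) - f ε (x + t))‖ := by
        congr 1; abel
    _ ≤ g ε + g ε := (norm_sub_le _ _).trans (add_le_add h₁ h₂)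
    _ = 2 * g ε := by ring

/-- Chaining increments along a segment. -/
theorem norm_sub_zero_le_of_increment_bound {E F : Type*} [NormedAddCommGroup E] [NormedSpace ℝ E]
    [SeminormedAddCommGroup F] {f : E → F} {R δ c : ℝ} {n : ℕ} (hn : 0 < n) (hnR : R / n < δ)
    (h : ∀ x t : E, ‖x‖ < δ → ‖t‖ ≤ R → ‖f (x + t) - f t‖ ≤ c) {t : E} (ht : ‖t‖ ≤ R) :
    ‖f t - f 0‖ ≤ n * c := by
  have hn' : (0 : ℝ) < n := Nat.cast_pos.2 hn
  have hstep : ∀ k ∈ Finset.range n,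
      ‖f (((k + 1 : ℕ) / n : ℝ) • t) - f ((k / n : ℝ) • t)‖ ≤ c := by
    intro k hk
    have hx : ‖((n : ℝ)⁻¹) • t‖ < δ := by
      rw [norm_smul, norm_inv, RCLike.norm_natCast, inv_mul_eq_div]
      exact (div_le_div_of_nonneg_right ht hn'.le).trans_lt hnR
    have ht' : ‖(k / n : ℝ) • t‖ ≤ R := by
      rw [norm_smul, Real.norm_of_nonneg (by positivity)]
      refine (mul_le_of_le_one_left (norm_nonneg t) ?_).trans ht
      exact div_le_one_of_le₀ (by exact_mod_cast (Finset.mem_range.1 hk).le) hn'.le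
    convert h _ _ hx ht' using 4
    rw [← add_smul]
    congr 1
    push_cast
    ring
  have hsum := Finset.sum_range_sub (fun k : ℕ ↦ f ((k / n : ℝ) • t)) n
  simp only [div_self hn'.ne', one_smul, Nat.cast_zero, zero_div, zero_smul] at hsum
  rw [← hsum]
  simpa using norm_sum_le_of_le _ hstep

theorem stmt19 {d : ℕ} (Mp : ℕ → ℝ) (hMpos : ∀ p, 0 < Mp p) (hM0 : Mp 0 = 1)
    (hM1 : CondM1 Mp) (hM2 : CondM2' Mp) (hM3 : CondM3 Mp)
    (f : ℝ → EuclideanSpace ℝ (Fin d) → ℂ)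
    (hcont : ∀ ε ∈ Set.Ioo (0 : ℝ) 1, Continuous (f ε))
    (hyp : ∀ R : ℕ, 0 < R → ∀ pseq : ℕ → ℝ, InRcal pseq → ∀ x : EuclideanSpace ℝ (Fin d),
      ∃ l : ℕ, 0 < l ∧ ∀ ε : ℝ, 0 < ε → ε < 1 / (l : ℝ) →
        ∀ t : EuclideanSpace ℝ (Fin d), ‖t‖ ≤ (R : ℝ) →
          ‖f ε (x + t) - f ε t‖ ≤ Real.exp (-assocN Mp pseq (1 / ε))) :
    ∀ R : ℕ, 0 < R → ∀ pseq : ℕ → ℝ, InRcal pseq → ∃ C : ℝ, 0 < C ∧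
      ∃ ε₀ ∈ Set.Ioo (0 : ℝ) 1,
        ∀ ε : ℝ, 0 < ε → ε < ε₀ → ∀ t : EuclideanSpace ℝ (Fin d), ‖t‖ ≤ (R : ℝ) →
          ‖f ε t - f ε 0‖ ≤ C * Real.exp (-assocN Mp pseq (1 / ε)) := by
  intro R hR pseq hpseq
  obtain ⟨δ, hδ, l, hl, h⟩ := exists_uniform_increment_bound f
    (fun ε ↦ Real.exp (-assocN Mp pseq (1 / ε))) R hcont
    (by simpa using hyp (R + 1) R.succ_pos pseq hpseq)
  obtain ⟨n, hn⟩ := exists_nat_gt ((R : ℝ) / δ)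
  have hn' : (0 : ℝ) < n := (div_nonneg R.cast_nonneg hδ.le).trans_lt hn
  have hnR : (R : ℝ) / n < δ := by
    rw [div_lt_iff₀ hδ] at hn
    rwa [div_lt_iff₀ hn', mul_comm]
  have hl' : (1 : ℝ) ≤ l := by exact_mod_cast hl
  refine ⟨n * 2, by positivity, 1 / (l + 1), ⟨by positivity, ?_⟩, fun ε hε hεl t ht ↦ ?_⟩
  · rw [div_lt_one (by positivity)]
    linarith
  · have hεl' : ε < 1 / (l : ℝ) :=
      hεl.trans (one_div_lt_one_div_of_lt (by positivity) (by linarith))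
    rw [mul_assoc]
    exact norm_sub_zero_le_of_increment_bound (Nat.cast_pos.1 hn') hnR (h ε hε hεl') ht
end
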